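/- arXiv:2407.07193 — 6 statements merged into one kernel-verified Lean document; each statement's English description precedes it below -/
import Mathlib

section
/- Let a ≥ 2 be an integer, x ∈ (0, 1/2], and δ ∈ [0, 1 − 1/a]. Then at least one of the following holds: (i) f_{a,x}(δ) − a·δ²/(a−1) ≤ x²/a; (ii) x ≤ (2·√(3a+1) − 4)/(3(a−1)) and f_{a,x}(δ) − a·δ²/(a−1) ≤ x·((a−1)x + 4)/(4a); (iii) (a−1)x² + 2x ≥ 1 and f_{a,x}(δ) − a·δ²/(a−1) ≤ x·( √((a−1)²x² + 2(a−1)x − (a−1))/a − (a−1)x/a + (1−x)/(ax) ). -/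
/-- `f_{a,x}(δ) := min( (1/a + δ)·x , (1/2)·(1/a + a·δ²/(a−1)) )`. -/
noncomputable def fax (a : ℕ) (x δ : ℝ) : ℝ :=
  min ((1 / (a : ℝ) + δ) * x) ((1 / 2) * (1 / (a : ℝ) + (a : ℝ) * δ ^ 2 / ((a : ℝ) - 1)))

/-- Subtracting the quadratic term from the linear branch of `fax` leaves a concave parabola,
bounded by its vertex value. -/
lemma linear_branch_sub_le {a : ℝ} (ha : 1 < a) (x δ : ℝ) :
    (1 / a + δ) * x - a * δ ^ 2 / (a - 1) ≤ x * ((a - 1) * x + 4) / (4 * a) := by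
  have hn : 0 < a - 1 := by linarith
  have ha0 : a ≠ 0 := by linarith
  have key : x * ((a - 1) * x + 4) / (4 * a) - ((1 / a + δ) * x - a * δ ^ 2 / (a - 1))
      = ((a - 1) * x - 2 * a * δ) ^ 2 / (4 * a * (a - 1)) := by
    field_simp
    ring
  have : 0 ≤ ((a - 1) * x - 2 * a * δ) ^ 2 / (4 * a * (a - 1)) := by positivity
  linarith

/-- Up to the crossing point `c / a` of the two branches, the linear branch minus the quadratic
term is at most its value there. -/
lemma linear_branch_sub_le_crossing {a x δ c : ℝ} (ha : 1 < a)
    (hc : c ^ 2 = 2 * (a - 1) * x * c - (a - 1) + 2 * (a - 1) * x)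
    (hcx : 2 * c ≤ (a - 1) * x) (hδ : a * δ ≤ c) :
    (1 / a + δ) * x - a * δ ^ 2 / (a - 1) ≤ (1 - x - c * x) / a := by
  have hn : 0 < a - 1 := by linarith
  have ha0 : a ≠ 0 := by linarith
  have key : (1 - x - c * x) / a - ((1 / a + δ) * x - a * δ ^ 2 / (a - 1))
      = (c - a * δ) * ((a - 1) * x - c - a * δ) / (a * (a - 1)) := by
    field_simp
    linear_combination hc
  have h : 0 ≤ (c - a * δ) * ((a - 1) * x - c - a * δ) :=
    mul_nonneg (by linarith) (by linarith)
  have : 0 ≤ (c - a * δ) * ((a - 1) * x - c - a * δ) / (a * (a - 1)) := by positivity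
  linarith

/-- Beyond the crossing point `c / a` of the two branches, the quadratic branch minus the quadratic
term is at most its value there. -/
lemma quadratic_branch_sub_le_crossing {a x δ c : ℝ} (ha : 1 < a)
    (hc : c ^ 2 = 2 * (a - 1) * x * c - (a - 1) + 2 * (a - 1) * x)
    (hc0 : 0 ≤ c) (hδ : c ≤ a * δ) :
    (1 / 2) * (1 / a + a * δ ^ 2 / (a - 1)) - a * δ ^ 2 / (a - 1) ≤ (1 - x - c * x) / a := by
  have hn : 0 < a - 1 := by linarith
  have ha0 : a ≠ 0 := by linarith
  have key : (1 - x - c * x) / a - ((1 / 2) * (1 / a + a * δ ^ 2 / (a - 1)) - a * δ ^ 2 / (a - 1))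
      = (a * δ - c) * (a * δ + c) / (2 * a * (a - 1)) := by
    field_simp
    linear_combination hc
  have h : 0 ≤ (a * δ - c) * (a * δ + c) := mul_nonneg (by linarith) (by linarith)
  have : 0 ≤ (a * δ - c) * (a * δ + c) / (2 * a * (a - 1)) := by positivity
  linarith

/-- Beyond the positive root of `3 (a - 1) x ^ 2 + 8 x - 4`, this polynomial is positive. -/
lemma four_lt_of_root_lt {a x : ℝ} (ha : 1 < a) (hx : 0 < x)
    (h : (2 * Real.sqrt (3 * a + 1) - 4) / (3 * (a - 1)) < x) :
    4 < 3 * (a - 1) * x ^ 2 + 8 * x := by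
  have hn : 0 < a - 1 := by linarith
  rw [div_lt_iff₀ (by positivity)] at h
  have hs : Real.sqrt (3 * a + 1) < (3 * (a - 1) * x + 4) / 2 := by linarith
  rw [Real.sqrt_lt' (by positivity)] at hs
  have h3 : 0 < (a - 1) * (3 * (a - 1) * x ^ 2 + 8 * x - 4) := by nlinarith
  linarith [pos_of_mul_pos_right h3 hn.le]

theorem stmt_2 (a : ℕ) (ha : 2 ≤ a) (x δ : ℝ) (hx0 : 0 < x) (hx2 : x ≤ 1 / 2)
    (hδ0 : 0 ≤ δ) (hδ1 : δ ≤ 1 - 1 / (a : ℝ)) :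
    (fax a x δ - (a : ℝ) * δ ^ 2 / ((a : ℝ) - 1) ≤ x ^ 2 / (a : ℝ)) ∨
    (x ≤ (2 * Real.sqrt (3 * (a : ℝ) + 1) - 4) / (3 * ((a : ℝ) - 1)) ∧
      fax a x δ - (a : ℝ) * δ ^ 2 / ((a : ℝ) - 1) ≤
        x * (((a : ℝ) - 1) * x + 4) / (4 * (a : ℝ))) ∨
    (1 ≤ ((a : ℝ) - 1) * x ^ 2 + 2 * x ∧
      fax a x δ - (a : ℝ) * δ ^ 2 / ((a : ℝ) - 1) ≤
        x * (Real.sqrt (((a : ℝ) - 1) ^ 2 * x ^ 2 + 2 * ((a : ℝ) - 1) * x - ((a : ℝ) - 1)) / (a : ℝ)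
          - ((a : ℝ) - 1) * x / (a : ℝ) + (1 - x) / ((a : ℝ) * x))) := by
  have ha1 : (1 : ℝ) < a := by exact_mod_cast ha
  rcases le_or_gt x ((2 * Real.sqrt (3 * (a : ℝ) + 1) - 4) / (3 * ((a : ℝ) - 1))) with h | h
  · exact Or.inr (Or.inl ⟨h, (sub_le_sub_right (min_le_left _ _) _).trans
      (linear_branch_sub_le ha1 x δ)⟩)
  have hx := four_lt_of_root_lt ha1 hx0 h
  unfold fax
  generalize (a : ℝ) = b at *
  have hn : 0 < b - 1 := by linarith
  have hnx : 0 < (b - 1) * x ^ 2 := by positivity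
  have hone : 1 ≤ (b - 1) * x ^ 2 + 2 * x := by nlinarith
  refine Or.inr (Or.inr ⟨hone, ?_⟩)
  set D := (b - 1) ^ 2 * x ^ 2 + 2 * (b - 1) * x - (b - 1) with hD
  have hS : Real.sqrt D ^ 2 = D := Real.sq_sqrt (by
    linarith [mul_nonneg hn.le (sub_nonneg.2 hone)])
  have hS_le : Real.sqrt D ≤ (b - 1) * x :=
    Real.sqrt_le_iff.2 ⟨by positivity, by
      linarith [mul_nonneg hn.le (sub_nonneg.2 hx2)]⟩
  have hS_ge : (b - 1) * x / 2 ≤ Real.sqrt D :=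
    Real.le_sqrt_of_sq_le (by linarith [mul_pos hn (sub_pos.2 hx)])
  have hbound : x * (Real.sqrt D / b - (b - 1) * x / b + (1 - x) / (b * x))
      = (1 - x - ((b - 1) * x - Real.sqrt D) * x) / b := by
    have hb0 : b ≠ 0 := by linarith
    field_simp
    ring
  have hc : ((b - 1) * x - Real.sqrt D) ^ 2
      = 2 * (b - 1) * x * ((b - 1) * x - Real.sqrt D) - (b - 1) + 2 * (b - 1) * x := by
    linear_combination hS + hD
  rw [hbound]
  rcases le_total (b * δ) ((b - 1) * x - Real.sqrt D) with hδ | hδ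
  · exact (sub_le_sub_right (min_le_left _ _) _).trans
      (linear_branch_sub_le_crossing ha1 hc (by linarith) hδ)
  · exact (sub_le_sub_right (min_le_right _ _) _).trans
      (quadratic_branch_sub_le_crossing ha1 hc (by linarith) hδ)
end

section
/- For every integer a ≥ 2, every x ∈ (0, 1/2], and every δ ∈ [0, 1 − 1/a], one has f_{a,x}(δ) < 2x/√a + a·δ²/(a−1). -/
theorem stmt_3 (a : ℕ) (ha : 2 ≤ a) (x δ : ℝ) (hx0 : 0 < x) (hx2 : x ≤ 1 / 2)
    (hδ0 : 0 ≤ δ) (hδ1 : δ ≤ 1 - 1 / (a : ℝ)) :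
    fax a x δ < 2 * x / Real.sqrt (a : ℝ) + (a : ℝ) * δ ^ 2 / ((a : ℝ) - 1) := by
  have ha2 : (2 : ℝ) ≤ a := by exact_mod_cast ha
  have ha1 : (0 : ℝ) < (a : ℝ) - 1 := by linarith
  set t : ℝ := 1 / Real.sqrt (a : ℝ) with ht
  have ht0 : 0 < t := by positivity
  have htt : 1 / (a : ℝ) = t ^ 2 := by
    rw [ht, div_pow, Real.sq_sqrt (by linarith), one_pow]
  have ht1 : t < 1 := by
    have h : 1 / (a : ℝ) < 1 := by
      rw [div_lt_one (by linarith)]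
      linarith
    nlinarith
  have hxt : 2 * x / Real.sqrt (a : ℝ) = 2 * x * t := by rw [ht, mul_one_div]
  have hq : δ ^ 2 ≤ (a : ℝ) * δ ^ 2 / ((a : ℝ) - 1) := by
    rw [le_div_iff₀ ha1]
    nlinarith [sq_nonneg δ]
  have hpos : 0 < x * t := mul_pos hx0 ht0
  rw [fax, htt, hxt]
  rcases le_total δ t with h | h
  · refine (min_le_left _ _).trans_lt ?_
    have h2 : t ^ 2 + δ < 2 * t := by nlinarith
    nlinarith [mul_lt_mul_of_pos_right h2 hx0, sq_nonneg δ]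
  · refine (min_le_right _ _).trans_lt ?_
    have h2 : t ^ 2 ≤ δ ^ 2 := by gcongr
    linarith
end

section
/- For every integer g ≥ 1, every integer r ≥ 0 such that r ≥ 1 if g = 1, every (possibly empty) non-decreasing sequence of integers 2 ≤ a_1 ≤ … ≤ a_r, every x ∈ (0, 1/2], and all real numbers δ_1,…,δ_r with δ_i ∈ [0, 1 − 1/a_i] for each i, one has Σ_{i=1}^r f_{a_i,x}(δ_i) < −0.44·x + (2g + r − 2)·x + Σ_{i=1}^r a_i·δ_i²/(a_i−1). -/
/-- The trivial termwise bound, coming from `δ ≤ 1 - 1/a`. -/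
theorem fax_le_add {a : ℕ} (ha : 2 ≤ a) {x δ : ℝ} (hx0 : 0 < x)
    (hδ1 : δ ≤ 1 - 1 / (a : ℝ)) :
    fax a x δ ≤ x + (a : ℝ) * δ ^ 2 / ((a : ℝ) - 1) := by
  have ha' : (2 : ℝ) ≤ a := by exact_mod_cast ha
  have hS : 0 ≤ (a : ℝ) * δ ^ 2 / ((a : ℝ) - 1) :=
    div_nonneg (by positivity) (by linarith)
  have h : (1 / (a : ℝ) + δ) * x ≤ 1 * x :=
    mul_le_mul_of_nonneg_right (by linarith) hx0.le
  exact (min_le_left _ _).trans (by linarith)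

/-- The termwise bound with a gain of `0.44 * x`. -/
theorem fax_lt_add {a : ℕ} (ha : 2 ≤ a) {x : ℝ} (hx0 : 0 < x) (hx2 : x ≤ 1 / 2) (δ : ℝ) :
    fax a x δ < 0.56 * x + (a : ℝ) * δ ^ 2 / ((a : ℝ) - 1) := by
  unfold fax
  rcases ha.eq_or_lt with rfl | ha
  · rcases le_or_gt x 0.45 with hx | hx
    · refine (min_le_left _ _).trans_lt ?_
      norm_num at hx ⊢
      nlinarith [sq_nonneg (δ - x / 4)]
    · refine (min_le_right _ _).trans_lt ?_
      norm_num at hx ⊢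
      nlinarith [sq_nonneg δ]
  · have ha' : (3 : ℝ) ≤ a := by exact_mod_cast ha
    have hinv : 1 / (a : ℝ) ≤ 1 / 3 := one_div_le_one_div_of_le (by norm_num) ha'
    have hS : δ ^ 2 ≤ (a : ℝ) * δ ^ 2 / ((a : ℝ) - 1) := by
      rw [le_div_iff₀ (by linarith)]
      nlinarith [sq_nonneg δ]
    have h : 1 / (a : ℝ) * x ≤ 1 / 3 * x := mul_le_mul_of_nonneg_right hinv hx0.le
    refine (min_le_left _ _).trans_lt ?_
    norm_num at h ⊢
    nlinarith [sq_nonneg (δ - x / 2)]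

theorem stmt_5 (g r : ℕ) (hg : 1 ≤ g) (hgr : g = 1 → 1 ≤ r)
    (a : Fin r → ℕ) (ha : ∀ i, 2 ≤ a i) (hmono : Monotone a)
    (x : ℝ) (hx0 : 0 < x) (hx2 : x ≤ 1 / 2)
    (δ : Fin r → ℝ) (hδ0 : ∀ i, 0 ≤ δ i) (hδ1 : ∀ i, δ i ≤ 1 - 1 / (a i : ℝ)) :
    ∑ i, fax (a i) x (δ i) <
      -(0.44 : ℝ) * x + (2 * (g : ℝ) + (r : ℝ) - 2) * x +
        ∑ i, (a i : ℝ) * δ i ^ 2 / ((a i : ℝ) - 1) := by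
  rcases hg.eq_or_lt with rfl | hg
  · obtain ⟨n, rfl⟩ := Nat.exists_eq_add_of_le' (hgr rfl)
    have h := Finset.sum_le_sum fun (i : Fin n) (_ : i ∈ Finset.univ) =>
      fax_le_add (ha i.succ) hx0 (hδ1 i.succ)
    have h0 := fax_lt_add (ha 0) hx0 hx2 (δ 0)
    rw [Finset.sum_add_distrib] at h
    simp only [Finset.sum_const, Finset.card_univ, Fintype.card_fin, nsmul_eq_mul] at h
    rw [Fin.sum_univ_succ, Fin.sum_univ_succ]
    push_cast
    linarith
  · have h := Finset.sum_le_sum fun (i : Fin r) (_ : i ∈ Finset.univ) =>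
      fax_le_add (ha i) hx0 (hδ1 i)
    rw [Finset.sum_add_distrib] at h
    simp only [Finset.sum_const, Finset.card_univ, Fintype.card_fin, nsmul_eq_mul] at h
    have hg' : (2 : ℝ) * x ≤ g * x :=
      mul_le_mul_of_nonneg_right (by exact_mod_cast hg) hx0.le
    linarith
end

section
/- Let q be a prime power, n a positive integer, G = GL_n(F_q), and let χ be an irreducible complex character of G whose true level j satisfies j ≤ n/2. Let t ≥ 2 and m_1,…,m_t ≥ 1 be integers with m_1 + … + m_t = n, let L ≤ G be the block-diagonal subgroup GL_{m_1}(F_q) × … × GL_{m_t}(F_q), and let U ≤ G be the group of block upper unitriangular matrices with respect to these blocks. Define the class function *R(χ) on L by *R(χ)(l) := |U|^{−1} · Σ_{u ∈ U} χ(lu). Then Σ_{η ∈ Irr(L)} ⟨η, *R(χ)⟩_L ≤ n^j · (j!)² · q^{4j²}, where ⟨−,−⟩_L is the standard inner product of class functions on L. -/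
open scoped MatrixGroups ComplexOrder

/-- The standard inner product of two class functions on a finite group `G`:
`⟨f₁, f₂⟩ = |G|⁻¹ ∑_{x ∈ G} f₁(x) conj(f₂(x))`. -/
noncomputable def charInner (G : Type) [Group G] (f₁ f₂ : G → ℂ) : ℂ :=
  (Nat.card G : ℂ)⁻¹ * ∑ᶠ x : G, f₁ x * (starRingEnd ℂ) (f₂ x)

/-- `χ : G → ℂ` is an irreducible (complex) character of `G`: it is the character
of some irreducible (finite-dimensional) complex representation of `G`. -/
def IsIrredCharacter {G : Type} [Group G] (χ : G → ℂ) : Prop :=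
  ∃ V : FDRep ℂ G, CategoryTheory.Simple V ∧ χ = V.character

/-- The permutation character `τ` of `GL_n(F_q)` acting on `F_q^n`:
`τ(g)` is the number of vectors fixed by `g`. -/
noncomputable def permChar (F : Type) [Field F] [Fintype F] (n : ℕ)
    (g : GL (Fin n) F) : ℂ :=
  (Nat.card {v : Fin n → F // (g : Matrix (Fin n) (Fin n) F).mulVec v = v} : ℂ)

theorem Representation.conj_character {G V : Type*} [Group G] [Finite G] [AddCommGroup V]
    [Module ℂ V] [FiniteDimensional ℂ V] (ρ : Representation ℂ G V) (g : G) :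
    (starRingEnd ℂ) (ρ.character g) = ρ.character g⁻¹ := by
  classical
  have := Fintype.ofFinite G
  let b := Module.finBasis ℂ V
  let A : G →* Matrix _ _ ℂ := (MonoidHomClass.toMonoidHom (LinearMap.toMatrixAlgEquiv b)).comp ρ
  have hA (x : G) : ρ.character x = (A x).trace := by
    change LinearMap.trace ℂ V (ρ x) = _
    rw [LinearMap.trace_eq_matrix_trace ℂ b]; rfl
  let H := ∑ x : G, (A x).conjTranspose * A x
  have hH : H.PosDef := by
    have : H = (A 1).conjTranspose * A 1 +
        ∑ x ∈ Finset.univ.erase (1 : G), (A x).conjTranspose * A x :=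
      (Finset.add_sum_erase _ _ (Finset.mem_univ _)).symm
    rw [this, map_one, Matrix.conjTranspose_one, one_mul]
    exact Matrix.PosDef.one.add_posSemidef
      (Matrix.posSemidef_sum _ fun x _ => Matrix.posSemidef_conjTranspose_mul_self _)
  have hinv : (A g).conjTranspose * H * A g = H := by
    simp only [H, Finset.mul_sum, Finset.sum_mul]
    refine Fintype.sum_equiv (Equiv.mulRight g) _ _ fun x => ?_
    simp [Matrix.conjTranspose_mul, Matrix.mul_assoc]
  have hH' := (Matrix.isUnit_iff_isUnit_det _).1 hH.isUnit
  have h1 : (A g).conjTranspose * H = H * A g⁻¹ := by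
    conv_rhs => rw [← hinv]
    rw [Matrix.mul_assoc _ (A g), ← map_mul]; simp
  have h2 : A g⁻¹ = H⁻¹ * ((A g).conjTranspose * H) := by
    rw [h1, ← Matrix.mul_assoc, Matrix.nonsing_inv_mul _ hH', one_mul]
  rw [hA, hA, h2, Matrix.trace_mul_comm, Matrix.mul_assoc, Matrix.mul_nonsing_inv _ hH', mul_one,
    Matrix.trace_conjTranspose]
  rfl

theorem charInner_eq_sum {G : Type} [Group G] [Fintype G] (f₁ f₂ : G → ℂ) :
    charInner G f₁ f₂ = (Nat.card G : ℂ)⁻¹ * ∑ x, f₁ x * (starRingEnd ℂ) (f₂ x) := by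
  rw [charInner, finsum_eq_sum_of_fintype]

theorem charInner_character {G : Type} [Group G] [Finite G] {V W : Type*} [AddCommGroup V]
    [Module ℂ V] [FiniteDimensional ℂ V] [AddCommGroup W] [Module ℂ W] [FiniteDimensional ℂ W]
    (ρ : Representation ℂ G V) (σ : Representation ℂ G W) :
    charInner G ρ.character σ.character = Module.finrank ℂ (σ.IntertwiningMap ρ) := by
  have := Fintype.ofFinite G
  have : Invertible (Nat.card G : ℂ) := invertibleOfNonzero (by simp)
  rw [charInner_eq_sum, ← Representation.card_inv_mul_sum_char_mul_char_eq_finrank]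
  simp_rw [Representation.conj_character]

theorem finrank_intertwiningMap_comm {G : Type} [Group G] [Finite G] {V W : Type*} [AddCommGroup V]
    [Module ℂ V] [FiniteDimensional ℂ V] [AddCommGroup W] [Module ℂ W] [FiniteDimensional ℂ W]
    (ρ : Representation ℂ G V) (σ : Representation ℂ G W) :
    Module.finrank ℂ (σ.IntertwiningMap ρ) = Module.finrank ℂ (ρ.IntertwiningMap σ) := by
  have := Fintype.ofFinite G
  have : Invertible (Nat.card G : ℂ) := invertibleOfNonzero (by simp)
  rw [← Nat.cast_inj (R := ℂ), ← Representation.card_inv_mul_sum_char_mul_char_eq_finrank,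
    ← Representation.card_inv_mul_sum_char_mul_char_eq_finrank]
  congr 1
  refine Fintype.sum_equiv (Equiv.inv G) _ _ fun x => ?_
  simp [mul_comm]

open scoped Classical in
theorem charInner_irred {G : Type} [Group G] [Finite G] {η η' : G → ℂ}
    (h : IsIrredCharacter η) (h' : IsIrredCharacter η') :
    charInner G η η' = if η = η' then 1 else 0 := by
  classical
  have := Fintype.ofFinite G
  have : Invertible (Nat.card G : ℂ) := invertibleOfNonzero (by simp)
  obtain ⟨V, hV, rfl⟩ := h
  obtain ⟨W, hW, rfl⟩ := h'
  have key := FDRep.char_orthonormal V W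
  have hc (x : G) : (starRingEnd ℂ) (W.character x) = W.character x⁻¹ :=
    Representation.conj_character W.ρ x
  simp_rw [charInner_eq_sum, hc]
  rw [key]
  by_cases hi : Nonempty (V ≅ W)
  · rw [if_pos hi, if_pos (FDRep.char_iso hi.some)]
  · rw [if_neg hi, if_neg]
    intro he
    have key2 := FDRep.char_orthonormal V V
    rw [if_pos ⟨CategoryTheory.Iso.refl V⟩] at key2
    rw [if_neg hi, ← he, key2] at key
    exact one_ne_zero key

theorem sum_sq_norm_charInner_le {G : Type} [Group G] [Fintype G] (S : Finset (G → ℂ))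
    (hS : ∀ η ∈ S, IsIrredCharacter η) (f : G → ℂ) :
    ∑ η ∈ S, ‖charInner G f η‖ ^ 2 ≤ (Nat.card G : ℝ)⁻¹ * ∑ x, ‖f x‖ ^ 2 := by
  classical
  let c : ℝ := Real.sqrt (Nat.card G : ℝ)⁻¹
  have hc : c * c = (Nat.card G : ℝ)⁻¹ := Real.mul_self_sqrt (by positivity)
  have hcC : (c : ℂ) * c = (Nat.card G : ℂ)⁻¹ := by
    rw [← Complex.ofReal_mul, hc]; simp
  let v : (G → ℂ) → EuclideanSpace ℂ G := fun η => WithLp.toLp 2 fun x => (c : ℂ) * η x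
  have hv (η f : G → ℂ) : inner ℂ (v η) (v f) = charInner G f η := by
    rw [charInner_eq_sum, PiLp.inner_apply, Finset.mul_sum]
    refine Finset.sum_congr rfl fun x _ => ?_
    simp only [v, RCLike.inner_apply, map_mul, Complex.conj_ofReal, ← hcC]
    ring
  have ho : Orthonormal ℂ fun η : S => v η := by
    rw [orthonormal_iff_ite]
    intro a a'
    rw [hv, charInner_irred (hS _ a'.2) (hS _ a.2)]
    simp only [eq_comm (a := (a' : G → ℂ)), Subtype.ext_iff]
  have := ho.sum_inner_products_le (v f) (s := Finset.univ)
  simp only [hv] at this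
  rw [Finset.sum_coe_sort S fun η => ‖charInner G f η‖ ^ 2] at this
  refine this.trans_eq ?_
  rw [EuclideanSpace.norm_sq_eq, Finset.mul_sum]
  refine Finset.sum_congr rfl fun x _ => ?_
  simp only [v, norm_mul, Complex.norm_real, mul_pow, Real.norm_eq_abs, sq_abs]
  rw [sq c, hc]

/-- The permutation representation of `P` on the complex functions on `X`. -/
noncomputable def permRep (P X : Type) [Group P] [MulAction P X] :
    Representation ℂ P (X → ℂ) where
  toFun p := LinearMap.funLeft ℂ ℂ fun x => p⁻¹ • x
  map_one' := by ext; simp [LinearMap.funLeft_apply]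
  map_mul' p q := by
    refine LinearMap.ext fun f => funext fun x => ?_
    simp [LinearMap.funLeft_apply, mul_smul]

theorem permRep_apply {P X : Type} [Group P] [MulAction P X] (p : P) (f : X → ℂ) (x : X) :
    permRep P X p f x = f (p⁻¹ • x) := rfl

theorem permRep_character {P X : Type} [Group P] [MulAction P X] [Finite X] (p : P) :
    (permRep P X).character p = Nat.card (MulAction.fixedBy X p) := by
  classical
  have := Fintype.ofFinite X
  change LinearMap.trace ℂ _ (permRep P X p) = _
  rw [LinearMap.trace_eq_matrix_trace ℂ (Pi.basisFun ℂ X), Matrix.trace]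
  simp only [Matrix.diag_apply, LinearMap.toMatrix_apply, Pi.basisFun_repr, permRep_apply,
    Pi.basisFun_apply, Pi.single_apply, Finset.sum_boole]
  rw [Nat.card_eq_fintype_card, Fintype.card_subtype]
  congr 2
  ext x
  simp [MulAction.mem_fixedBy, eq_inv_smul_iff, eq_comm]

section InvariantFiber

variable {P X D : Type} [Group P] [MulAction P X]

/-- A fibre of an invariant function is stable under the action. -/
abbrev fiberAction (inv : X → D) (hinv : ∀ (p : P) x, inv (p • x) = inv x) (d : D) :
    MulAction P {x // inv x = d} where
  smul p x := ⟨p • x.1, (hinv p x.1).trans x.2⟩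
  one_smul x := Subtype.ext (one_smul P x.1)
  mul_smul p q x := Subtype.ext (mul_smul p q x.1)

/-- The fibre product of `P` with itself over `L`. -/
abbrev fiberSquare {L : Type} [Group L] (β : P →* L) : Subgroup (P × P) :=
  (β.comp (MonoidHom.fst P P)).eqLocus (β.comp (MonoidHom.snd P P))

/-- The fibre product of `P` with itself over `L` acts on pairs with the same invariant. -/
abbrev pairAction {L : Type} [Group L] (β : P →* L) (inv : X → D)
    (hinv : ∀ (p : P) x, inv (p • x) = inv x) :
    MulAction (fiberSquare β)
      {z : X × X // inv z.1 = inv z.2} where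
  smul p z := ⟨(p.1.1 • z.1.1, p.1.2 • z.1.2), by simp only [hinv, z.2]⟩
  one_smul z := Subtype.ext (Prod.ext (one_smul P z.1.1) (one_smul P z.1.2))
  mul_smul p q z := Subtype.ext (Prod.ext (mul_smul p.1.1 q.1.1 z.1.1) (mul_smul p.1.2 q.1.2 z.1.2))

variable [Finite X]

/-- The permutation character of `P` on the fibre of `inv` over `d`. -/
noncomputable def fiberChar (inv : X → D) (d : D) (p : P) : ℕ :=
  Nat.card {x : X // inv x = d ∧ p • x = x}

theorem sum_fiberChar [Fintype D] (inv : X → D) (p : P) :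
    ∑ d, fiberChar inv d p = Nat.card (MulAction.fixedBy X p) := by
  simp only [fiberChar]
  rw [← Nat.card_sigma]
  exact Nat.card_congr
    { toFun := fun x => ⟨x.2.1, x.2.2.2⟩
      invFun := fun x => ⟨inv x.1, x.1, rfl, x.2⟩
      left_inv := by rintro ⟨d, x, rfl, h⟩; rfl
      right_inv := fun x => rfl }

theorem exists_charInner_fiberChar [Finite P] (inv : X → D)
    (hinv : ∀ (p : P) x, inv (p • x) = inv x) (d : D) {V : Type*} [AddCommGroup V]
    [Module ℂ V] [FiniteDimensional ℂ V] (σ : Representation ℂ P V) :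
    ∃ c : ℕ, charInner P (fun p => (fiberChar inv d p : ℂ)) σ.character = c := by
  let _ := fiberAction inv hinv d
  have : (fun p : P => (fiberChar inv d p : ℂ)) = (permRep P {x // inv x = d}).character := by
    ext p
    rw [permRep_character, fiberChar]
    congr 1
    exact Nat.card_congr
      { toFun := fun x => ⟨⟨x.1, x.2.1⟩, Subtype.ext x.2.2⟩
        invFun := fun x => ⟨x.1.1, x.1.2, congrArg Subtype.val x.2⟩
        left_inv := fun _ => rfl
        right_inv := fun _ => rfl }
  exact ⟨_, this ▸ charInner_character _ σ⟩

theorem sum_fiberChar_mul_le [Finite P] [Fintype D] {L C : Type} [Group L] [Finite C] (β : P →* L)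
    (inv : X → D) (hinv : ∀ (p : P) x, inv (p • x) = inv x)
    (code : {z : X × X // inv z.1 = inv z.2} → C)
    (hcode : ∀ z z', code z = code z' →
      ∃ p p', β p = β p' ∧ p • z.1.1 = z'.1.1 ∧ p' • z.1.2 = z'.1.2) :
    ∑ᶠ p : fiberSquare β,
      ∑ d, fiberChar inv d p.1.1 * fiberChar inv d p.1.2 ≤
      Nat.card C * Nat.card (fiberSquare β) := by
  classical
  let _ := pairAction β inv hinv
  have := Fintype.ofFinite (fiberSquare β)
  have := Fintype.ofFinite {z : X × X // inv z.1 = inv z.2}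
  have := Fintype.ofFinite (MulAction.orbitRel.Quotient (fiberSquare β) {z : X × X // inv z.1 = inv z.2})
  have hfix (p : fiberSquare β) : ∑ d, fiberChar inv d p.1.1 * fiberChar inv d p.1.2 =
      Fintype.card (MulAction.fixedBy {z : X × X // inv z.1 = inv z.2} p) := by
    simp only [fiberChar]
    simp_rw [← Nat.card_prod]
    rw [← Nat.card_sigma, ← Nat.card_eq_fintype_card]
    exact Nat.card_congr
      { toFun := fun x => ⟨⟨(x.2.1.1, x.2.2.1), x.2.1.2.1.trans x.2.2.2.1.symm⟩,
          Subtype.ext (Prod.ext x.2.1.2.2 x.2.2.2.2)⟩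
        invFun := fun z => ⟨inv z.1.1.1, ⟨z.1.1.1, rfl, congrArg (fun z : {z : X × X // inv z.1 = inv z.2} => z.1.1) z.2⟩,
          ⟨z.1.1.2, z.1.2.symm, congrArg (fun z : {z : X × X // inv z.1 = inv z.2} => z.1.2) z.2⟩⟩
        left_inv := by rintro ⟨d, ⟨x, rfl, h⟩, y, h1, h2⟩; rfl
        right_inv := fun _ => rfl }
  rw [finsum_eq_sum_of_fintype]
  simp_rw [hfix]
  rw [MulAction.sum_card_fixedBy_eq_card_orbits_mul_card_group, ← Nat.card_eq_fintype_card (α := fiberSquare β)]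
  refine Nat.mul_le_mul_right _ ?_
  rw [← Nat.card_eq_fintype_card]
  refine Nat.card_le_card_of_injective (fun o => code o.out) fun o o' h => ?_
  obtain ⟨p, p', h1, h2, h3⟩ := hcode _ _ h
  rw [← Quotient.out_eq' o, ← Quotient.out_eq' o']
  refine (Quotient.sound' ?_).symm
  exact ⟨⟨(p, p'), h1⟩, Subtype.ext (Prod.ext h2 h3)⟩

end InvariantFiber

theorem mem_fiberSquare {P L : Type} [Group P] [Group L] {β : P →* L} {p : P × P} :
    p ∈ fiberSquare β ↔ β p.1 = β p.2 := Iff.rfl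

theorem card_fiberSquare {P L : Type} [Group P] [Finite P] [Group L] (β : P →* L)
    (hβ : Function.Surjective β) :
    Nat.card (fiberSquare β) * Nat.card L = Nat.card P ^ 2 := by
  have e : fiberSquare β ≃ P × β.ker :=
    { toFun := fun p => (p.1.1, ⟨p.1.1⁻¹ * p.1.2, by
        have := mem_fiberSquare.1 p.2
        simp [MonoidHom.mem_ker, this]⟩)
      invFun := fun x => ⟨(x.1, x.1 * x.2), by
        have := x.2.2
        rw [MonoidHom.mem_ker] at this
        simp [mem_fiberSquare, this]⟩
      left_inv := fun p => by simp
      right_inv := fun x => by simp }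
  have h := Subgroup.card_mul_index β.ker
  rw [Subgroup.index_ker, MonoidHom.range_eq_top.2 hβ, Subgroup.card_top] at h
  rw [Nat.card_congr e, Nat.card_prod, mul_assoc, h, sq]

theorem sum_fiberSquare {P L M : Type} [Group P] [Fintype P] [Group L] [Fintype L] [DecidableEq L]
    [AddCommMonoid M] (β : P →* L) (F : P → P → M) :
    ∑ l, ∑ p with β p = l, ∑ p' with β p' = l, F p p' =
      ∑ᶠ p : fiberSquare β, F p.1.1 p.1.2 := by
  classical
  have := Fintype.ofFinite (fiberSquare β)
  rw [finsum_eq_sum_of_fintype]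
  simp_rw [Finset.sum_filter]
  rw [Finset.sum_comm]
  have h1 : ∀ p, ∑ l, (if β p = l then ∑ p', if β p' = l then F p p' else 0 else 0) =
      ∑ p', if β p' = β p then F p p' else 0 := by
    intro p; rw [Finset.sum_ite_eq]; simp
  simp_rw [h1]
  rw [← Fintype.sum_prod_type' (f := fun p p' => if β p' = β p then F p p' else 0),
    ← Finset.sum_filter]
  refine Finset.sum_subtype _ (fun x => ?_) _
  simp [mem_fiberSquare, eq_comm]

theorem charInner_comm {P V W : Type} [Group P] [Finite P] [AddCommGroup V]
    [Module ℂ V] [FiniteDimensional ℂ V] [AddCommGroup W] [Module ℂ W] [FiniteDimensional ℂ W]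
    (ρ : Representation ℂ P V) (σ : Representation ℂ P W) :
    charInner P ρ.character σ.character = charInner P σ.character ρ.character := by
  rw [charInner_character, charInner_character, finrank_intertwiningMap_comm]

theorem finrank_intertwiningMap_le {P U V W : Type} [Group P]
    [AddCommGroup U] [Module ℂ U] [FiniteDimensional ℂ U] [AddCommGroup V] [Module ℂ V]
    [AddCommGroup W] [Module ℂ W] [FiniteDimensional ℂ W] {ρ : Representation ℂ P V}
    {τ : Representation ℂ P W} (σ : Representation ℂ P U) (f : ρ.IntertwiningMap τ)
    (hf : Function.Injective f) :
    Module.finrank ℂ (σ.IntertwiningMap ρ) ≤ Module.finrank ℂ (σ.IntertwiningMap τ) := by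
  refine LinearMap.finrank_le_finrank_of_injective
    (f := ({ toFun := fun g => f.comp g
             map_add' := fun g h => Representation.IntertwiningMap.add_comp _ _ _ f g h
             map_smul' := fun a g => Representation.IntertwiningMap.ext (LinearMap.ext fun x =>
              map_smul f.toLinearMap a (g x)) } :
        σ.IntertwiningMap ρ →ₗ[ℂ] σ.IntertwiningMap τ)) fun g h hgh => ?_
  refine Representation.IntertwiningMap.ext (LinearMap.ext fun x => hf ?_)
  exact congrArg (fun k : σ.IntertwiningMap τ => k x) hgh

theorem sum_charInner_comp_le {P L X D C V : Type} [Group P] [Finite P] [Group L] [Finite L]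
    [MulAction P X] [Finite X] [Finite D] [Finite C] (β : P →* L) (hβ : Function.Surjective β)
    (inv : X → D) (hinv : ∀ (p : P) x, inv (p • x) = inv x)
    (code : {z : X × X // inv z.1 = inv z.2} → C)
    (hcode : ∀ z z', code z = code z' →
      ∃ p p', β p = β p' ∧ p • z.1.1 = z'.1.1 ∧ p' • z.1.2 = z'.1.2)
    [AddCommGroup V] [Module ℂ V] [FiniteDimensional ℂ V] (ρ : Representation ℂ P V)
    (f : ρ.IntertwiningMap (permRep P X)) (hf : Function.Injective f)
    (S : Finset (L → ℂ)) (hS : ∀ η ∈ S, IsIrredCharacter η) :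
    ∑ η ∈ S, charInner P (η ∘ β) ρ.character ≤ Nat.card C := by
  classical
  have := Fintype.ofFinite P
  have := Fintype.ofFinite L
  have := Fintype.ofFinite D
  let φ (d : D) (p : P) : ℂ := fiberChar inv d p
  have hc : ∀ (η : L → ℂ) (d : D), ∃ c : ℕ, η ∈ S → charInner P (φ d) (η ∘ β) = c := by
    intro η d
    by_cases hη : η ∈ S
    · obtain ⟨W, -, rfl⟩ := hS η hη
      obtain ⟨c, hc⟩ := exists_charInner_fiberChar inv hinv d (W.ρ.comp β)
      exact ⟨c, fun _ => hc⟩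
    · exact ⟨0, fun h => absurd h hη⟩
  choose c hc using hc
  let E (d : D) (l : L) : ℂ := (Nat.card L : ℂ) / Nat.card P * ∑ p with β p = l, φ d p
  have hE (η : L → ℂ) (d : D) : charInner L (E d) η = charInner P (φ d) (η ∘ β) := by
    have hL : (Nat.card L : ℂ) ≠ 0 := by simp
    rw [charInner_eq_sum, charInner_eq_sum, ← Finset.sum_fiberwise Finset.univ β,
      Finset.mul_sum, Finset.mul_sum]
    refine Finset.sum_congr rfl fun l _ => ?_
    have h : ∑ p with β p = l, φ d p * (starRingEnd ℂ) ((η ∘ β) p) =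
        (∑ p with β p = l, φ d p) * (starRingEnd ℂ) (η l) := by
      rw [Finset.sum_mul]
      refine Finset.sum_congr rfl fun p hp => ?_
      rw [Function.comp_apply, (Finset.mem_filter.1 hp).2]
    rw [h]
    simp only [E]
    field_simp
  have hle (η : L → ℂ) (hη : η ∈ S) :
      charInner P (η ∘ β) ρ.character ≤ ((∑ d, c η d : ℕ) : ℂ) := by
    obtain ⟨W, -, hW⟩ := hS η hη
    let σ : Representation ℂ P W := W.ρ.comp β
    have hWβ : η ∘ β = σ.character := by rw [hW]; rfl
    have h1 : ((∑ d, c η d : ℕ) : ℂ) = Module.finrank ℂ (σ.IntertwiningMap (permRep P X)) := by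
      rw [← charInner_character, ← hWβ]
      push_cast
      simp_rw [← hc η _ hη, charInner_eq_sum, ← Finset.mul_sum]
      rw [Finset.sum_comm]
      simp_rw [← Finset.sum_mul, permRep_character, ← sum_fiberChar inv, φ]
      push_cast
      rfl
    rw [h1, hWβ, charInner_comm, charInner_character, Nat.cast_le]
    exact finrank_intertwiningMap_le σ f hf
  have hsq (d : D) : (∑ η ∈ S, c η d : ℝ) ≤ (Nat.card L : ℝ)⁻¹ * ∑ l, ‖E d l‖ ^ 2 := by
    refine le_trans (Finset.sum_le_sum fun η hη => ?_) (sum_sq_norm_charInner_le S hS (E d))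
    rw [hE, hc η d hη, Complex.norm_natCast]
    exact_mod_cast Nat.le_self_pow two_ne_zero _
  have hEn (d : D) : ∑ l, ‖E d l‖ ^ 2 = ((Nat.card L : ℝ) / Nat.card P) ^ 2 *
      ((∑ᶠ p : fiberSquare β, fiberChar inv d p.1.1 * fiberChar inv d p.1.2 : ℕ) : ℝ) := by
    rw [← sum_fiberSquare β fun p p' => fiberChar inv d p * fiberChar inv d p']
    push_cast
    rw [Finset.mul_sum]
    refine Finset.sum_congr rfl fun l _ => ?_
    simp only [E, φ, norm_mul, norm_div, Complex.norm_natCast, mul_pow, ← Nat.cast_sum]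
    rw [← Finset.sum_mul_sum]
    push_cast
    ring
  have hmain : (∑ d, ∑ η ∈ S, c η d : ℝ) ≤ Nat.card C := by
    refine (Finset.sum_le_sum fun d _ => hsq d).trans ?_
    simp_rw [hEn, ← Finset.mul_sum]
    rw [← Nat.cast_sum]
    have h1 := sum_fiberChar_mul_le β inv hinv code hcode
    have h2 := card_fiberSquare β hβ
    have hL : (Nat.card L : ℝ) ≠ 0 := by simp
    have hP : (Nat.card P : ℝ) ≠ 0 := by simp
    have h3 : (∑ d, ∑ᶠ p : fiberSquare β, fiberChar inv d p.1.1 * fiberChar inv d p.1.2) ≤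
        Nat.card C * Nat.card (fiberSquare β) := by
      refine le_trans (le_of_eq ?_) h1
      have := Fintype.ofFinite (fiberSquare β)
      simp_rw [finsum_eq_sum_of_fintype]
      exact Finset.sum_comm
    have h4 : (Nat.card P : ℝ) ^ 2 = Nat.card (fiberSquare β) * Nat.card L := by exact_mod_cast h2.symm
    calc _ ≤ (Nat.card L : ℝ)⁻¹ * (((Nat.card L : ℝ) / Nat.card P) ^ 2 *
          ((Nat.card C * Nat.card (fiberSquare β) : ℕ) : ℝ)) := by gcongr
      _ = (Nat.card C : ℝ) * (Nat.card (fiberSquare β) * Nat.card L / (Nat.card P : ℝ) ^ 2) := by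
          push_cast; field_simp
      _ = Nat.card C := by rw [← h4]; field_simp
  refine (Finset.sum_le_sum hle).trans ?_
  rw [← Nat.cast_sum, Nat.cast_le, Finset.sum_comm]
  exact_mod_cast hmain

theorem injective_of_simple {G W : Type} [Group G] [Finite G] [AddCommGroup W] [Module ℂ W]
    [FiniteDimensional ℂ W] (V : FDRep ℂ G) [CategoryTheory.Simple V] (σ : Representation ℂ G W)
    (f : Representation.IntertwiningMap V.ρ σ) (hf : f ≠ 0) : Function.Injective f := by
  let φ : V ⟶ FDRep.of σ := ⟨FGModuleCat.ofHom f.toLinearMap, fun g => by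
    ext x
    exact f.isIntertwining V.ρ σ g x⟩
  have hφ : φ ≠ 0 := fun h => hf <| by
    refine Representation.IntertwiningMap.ext (LinearMap.ext fun x => ?_)
    have := congrArg (fun ψ : V ⟶ FDRep.of σ => ψ.hom.hom.hom x) h
    exact this
  have := CategoryTheory.mono_of_nonzero_from_simple hφ
  let K : Submodule ℂ V := LinearMap.ker f.toLinearMap
  have hK (g : G) : ∀ x ∈ K, V.ρ g x ∈ K := fun x hx => by
    have h : f x = 0 := hx
    change f (V.ρ g x) = 0
    rw [f.isIntertwining, h, map_zero]
  let κ : Representation ℂ G K :=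
    { toFun := fun g => (V.ρ g).restrict (hK g)
      map_one' := by ext; simp
      map_mul' := fun g h => by ext; simp }
  let i : FDRep.of κ ⟶ V := ⟨FGModuleCat.ofHom K.subtype, fun g => by ext x; rfl⟩
  have hi : CategoryTheory.CategoryStruct.comp i φ = 0 := by
    ext x
    exact x.2
  have hi0 : i = 0 := (CategoryTheory.cancel_mono φ).1 (hi.trans CategoryTheory.Limits.zero_comp.symm)
  refine (injective_iff_map_eq_zero f.toLinearMap).2 fun x hx => ?_
  have := congrArg (fun ψ : FDRep.of κ ⟶ V => ψ.hom.hom.hom (⟨x, hx⟩ : K)) hi0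
  exact this

theorem exists_injective_intertwiningMap_permRep {G X : Type} [Group G] [Finite G] [MulAction G X]
    [Finite X] (V : FDRep ℂ G) [CategoryTheory.Simple V]
    (h : charInner G V.character (fun g => (Nat.card (MulAction.fixedBy X g) : ℂ)) ≠ 0) :
    ∃ f : Representation.IntertwiningMap V.ρ (permRep G X), Function.Injective f := by
  have h1 : (fun g => (Nat.card (MulAction.fixedBy X g) : ℂ)) = (permRep G X).character :=
    funext fun g => (permRep_character g).symm
  have h2 : charInner G V.character (permRep G X).character = _ := charInner_character V.ρ _
  rw [h1, h2, finrank_intertwiningMap_comm, Nat.cast_ne_zero] at h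
  have := Module.nontrivial_of_finrank_pos (Nat.pos_of_ne_zero h)
  obtain ⟨f, hf⟩ := exists_ne (0 : Representation.IntertwiningMap V.ρ (permRep G X))
  exact ⟨f, injective_of_simple V _ f hf⟩

/-- The product `U × L → G`, as a homomorphism from the semidirect product. -/
noncomputable def semidirectToGroup {G : Type} [Group G] (L U : Subgroup G)
    (h : L ≤ Subgroup.normalizer (U : Set G)) :
    U ⋊[U.normalizerMonoidHom.comp (Subgroup.inclusion h)] L →* G :=
  SemidirectProduct.lift U.subtype L.subtype fun l => by
    ext u
    simp

theorem semidirectToGroup_apply {G : Type} [Group G] (L U : Subgroup G)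
    (h : L ≤ Subgroup.normalizer (U : Set G))
    (p : U ⋊[U.normalizerMonoidHom.comp (Subgroup.inclusion h)] L) :
    semidirectToGroup L U h p = p.left * p.right := rfl

theorem charInner_average {G : Type} [Group G] [Finite G] (L U : Subgroup G)
    (h : L ≤ Subgroup.normalizer (U : Set G)) (η : L → ℂ) (χ : G → ℂ) :
    charInner L η (fun l : L => (Nat.card U : ℂ)⁻¹ * ∑ᶠ u : U, χ (l * u)) =
      charInner (U ⋊[U.normalizerMonoidHom.comp (Subgroup.inclusion h)] L)
        (η ∘ SemidirectProduct.rightHom) (χ ∘ semidirectToGroup L U h) := by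
  have := Fintype.ofFinite L
  have := Fintype.ofFinite U
  let e : U ⋊[U.normalizerMonoidHom.comp (Subgroup.inclusion h)] L ≃ U × L :=
    SemidirectProduct.equivProd
  have := Fintype.ofEquiv _ e.symm
  rw [charInner_eq_sum, charInner_eq_sum, Nat.card_congr e, Nat.card_prod, ← e.symm.sum_comp,
    Fintype.sum_prod_type_right]
  push_cast
  rw [mul_inv, mul_comm (Nat.card U : ℂ)⁻¹, mul_assoc, Finset.mul_sum (a := (Nat.card U : ℂ)⁻¹)]
  congr 1
  refine Finset.sum_congr rfl fun l _ => ?_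
  rw [finsum_eq_sum_of_fintype, map_mul, map_sum, mul_left_comm, Finset.mul_sum]
  congr 1
  · simp
  refine Fintype.sum_equiv ((U.normalizerMonoidHom.comp (Subgroup.inclusion h)) l).toEquiv _ _
    fun u => ?_
  simp [e, semidirectToGroup_apply]

/-- Harish-Chandra-type restriction: if `χ` is a constituent of the permutation character on `X`, the
length of its average over `U` is at most the number of values of `code`. -/
theorem sum_charInner_average_le {G X D C : Type} [Group G] [Finite G] [MulAction G X] [Finite X]
    [Finite D] [Finite C] (L U : Subgroup G) (h : L ≤ Subgroup.normalizer (U : Set G)) (χ : G → ℂ)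
    (hχ : IsIrredCharacter χ)
    (hX : charInner G χ (fun g => (Nat.card (MulAction.fixedBy X g) : ℂ)) ≠ 0)
    (inv : X → D) (hinvL : ∀ g ∈ L, ∀ x, inv (g • x) = inv x)
    (hinvU : ∀ g ∈ U, ∀ x, inv (g • x) = inv x)
    (code : {z : X × X // inv z.1 = inv z.2} → C)
    (hcode : ∀ z z', code z = code z' → ∃ l ∈ L, ∃ u ∈ U, ∃ u' ∈ U,
      u • l • z.1.1 = z'.1.1 ∧ u' • l • z.1.2 = z'.1.2)
    (S : Finset (L → ℂ)) (hS : ∀ η ∈ S, IsIrredCharacter η) :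
    ∑ η ∈ S, charInner L η (fun l : L => (Nat.card U : ℂ)⁻¹ * ∑ᶠ u : U, χ (l * u)) ≤
      Nat.card C := by
  obtain ⟨V, hV, rfl⟩ := hχ
  obtain ⟨f, hf⟩ := exists_injective_intertwiningMap_permRep V hX
  simp_rw [charInner_average L U h]
  let α := semidirectToGroup L U h
  have : Finite (U ⋊[U.normalizerMonoidHom.comp (Subgroup.inclusion h)] L) :=
    Finite.of_equiv _ SemidirectProduct.equivProd.symm
  let _ : MulAction (U ⋊[U.normalizerMonoidHom.comp (Subgroup.inclusion h)] L) X :=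
    MulAction.compHom X α
  have hα (p : U ⋊[U.normalizerMonoidHom.comp (Subgroup.inclusion h)] L) (x : X) :
      p • x = (p.left : G) • (p.right : G) • x := by
    rw [← mul_smul]; rfl
  let ρ : Representation ℂ (U ⋊[U.normalizerMonoidHom.comp (Subgroup.inclusion h)] L) V :=
    V.ρ.comp α
  let f' : ρ.IntertwiningMap (permRep _ X) := ⟨f.toLinearMap, fun p => by
    refine LinearMap.ext fun v => ?_
    refine (f.isIntertwining V.ρ _ (α p) v).trans ?_
    ext x
    change f v ((α p)⁻¹ • x) = f v (α p⁻¹ • x)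
    rw [map_inv]⟩
  refine sum_charInner_comp_le SemidirectProduct.rightHom SemidirectProduct.rightHom_surjective inv
    (fun p x => ?_) code (fun z z' hz => ?_) ρ f' hf S hS
  · rw [hα, hinvU _ p.left.2, hinvL _ p.right.2]
  · obtain ⟨l, hl, u, hu, u', hu', h1, h2⟩ := hcode z z' hz
    exact ⟨⟨⟨u, hu⟩, ⟨l, hl⟩⟩, ⟨⟨u', hu'⟩, ⟨l, hl⟩⟩, rfl, (hα _ _).trans h1, (hα _ _).trans h2⟩

section LinearAlgebra

variable {F V W E : Type*} [Field F] [AddCommGroup V] [Module F V] [AddCommGroup W] [Module F W]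
  [AddCommGroup E] [Module F E]

theorem LinearMap.exists_linearEquiv_comp_eq [FiniteDimensional F E] (f g : E →ₗ[F] W)
    (h : LinearMap.range f = LinearMap.range g) :
    ∃ e : E ≃ₗ[F] E, ∀ x, f (e x) = g x := by
  obtain ⟨A, hA⟩ := Submodule.exists_isCompl (LinearMap.ker f)
  obtain ⟨B, hB⟩ := Submodule.exists_isCompl (LinearMap.ker g)
  let φ : A ≃ₗ[F] LinearMap.range f :=
    (Submodule.quotientEquivOfIsCompl _ _ hA).symm.trans f.quotKerEquivRange
  let ψ : B ≃ₗ[F] LinearMap.range g :=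
    (Submodule.quotientEquivOfIsCompl _ _ hB).symm.trans g.quotKerEquivRange
  have hφ (a : A) : (φ a : W) = f a := by simp [φ]
  have hψ (a : B) : (ψ a : W) = g a := by simp [ψ]
  have hk : Module.finrank F (LinearMap.ker g) = Module.finrank F (LinearMap.ker f) := by
    have h1 := f.finrank_range_add_finrank_ker
    have h2 := g.finrank_range_add_finrank_ker
    rw [h] at h1
    omega
  let θ : B ≃ₗ[F] A := ψ.trans ((LinearEquiv.ofEq _ _ h.symm).trans φ.symm)
  have hθ (a : B) : f (θ a) = g a := by
    rw [← hφ, ← hψ]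
    simp [θ]
  refine ⟨((Submodule.prodEquivOfIsCompl _ _ hB).symm.trans
    ((LinearEquiv.ofFinrankEq _ _ hk).prodCongr θ)).trans (Submodule.prodEquivOfIsCompl _ _ hA),
    fun x => ?_⟩
  obtain ⟨⟨y, z⟩, rfl⟩ := (Submodule.prodEquivOfIsCompl _ _ hB).surjective x
  have hy : g y = 0 := y.2
  simp [hθ, hy]

theorem Submodule.exists_sup_span_range_eq [FiniteDimensional F W] {κ : Type*} [Fintype κ]
    {A B : Submodule F W} (h : A ≤ B)
    (hκ : Module.finrank F B ≤ Module.finrank F A + Fintype.card κ) :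
    ∃ w : κ → W, A ⊔ Submodule.span F (Set.range w) = B := by
  obtain ⟨C, hC⟩ := Submodule.exists_isCompl A
  have h1 : A ⊔ C ⊓ B = B := by
    rw [← sup_inf_assoc_of_le _ h, hC.sup_eq_top, top_inf_eq]
  have h2 := Submodule.finrank_sup_add_finrank_inf_eq A (C ⊓ B)
  rw [h1, ← inf_assoc, hC.inf_eq_bot, bot_inf_eq, finrank_bot] at h2
  obtain ⟨e⟩ : Nonempty (Fin (Module.finrank F ↥(C ⊓ B)) ↪ κ) :=
    Function.Embedding.nonempty_of_card_le (by rw [Fintype.card_fin]; omega)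
  let v := Module.finBasis F ↥(C ⊓ B)
  refine ⟨Function.extend e (fun i => (v i : W)) 0, ?_⟩
  rw [Set.range_extend e.injective, Submodule.span_union]
  have h3 : Submodule.span F ((0 : κ → W) '' (Set.range e)ᶜ) = ⊥ := by
    rw [Submodule.span_eq_bot]
    rintro _ ⟨k, -, rfl⟩
    rfl
  have h4 : Submodule.span F (Set.range fun i => (v i : W)) = C ⊓ B := by
    have := congrArg (Submodule.map (C ⊓ B).subtype) v.span_eq
    rw [Submodule.map_span, ← Set.range_comp, Submodule.map_top, Submodule.range_subtype] at this
    exact this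
  rw [h3, h4, sup_bot_eq, h1]

end LinearAlgebra

section BlockMatrices

open scoped Matrix.Module

variable {F V W ι : Type*} [Field F] [AddCommGroup V] [Module F V] [AddCommGroup W] [Module F W]
  [Fintype ι] [DecidableEq ι]

theorem Fintype.sum_eq_sum_subtype {ι A : Type*} [Fintype ι] [AddCommMonoid A] (P : ι → Prop)
    [DecidablePred P] (f : ι → A) (hf : ∀ r, ¬ P r → f r = 0) :
    ∑ r, f r = ∑ r : {r // P r}, f r := by
  rw [← Finset.sum_subtype (Finset.univ.filter P) (by simp) f, Finset.sum_filter]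
  refine Finset.sum_congr rfl fun r _ => ?_
  split_ifs with h
  exacts [rfl, hf r h]

theorem exists_blockDiagonal_smul_sub_mem (c : ι → ℕ) (p w : ι → W) (N : ℕ → Submodule F W)
    (h : ∀ i, N i ⊔ Submodule.span F (p '' {r | c r = i}) =
      N i ⊔ Submodule.span F (w '' {r | c r = i})) :
    ∃ g : GL ι F, (∀ r s, c r ≠ c s → g.1 r s = 0) ∧
      ∀ r, (g.1 • p) r - w r ∈ N (c r) := by
  have key (i : ℕ) : ∃ e : ({r // c r = i} → F) ≃ₗ[F] ({r // c r = i} → F), ∀ a,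
      Fintype.linearCombination F (fun r : {r // c r = i} => (N i).mkQ (p r)) (e a) =
        Fintype.linearCombination F (fun r : {r // c r = i} => (N i).mkQ (w r)) a := by
    refine LinearMap.exists_linearEquiv_comp_eq _ _ ?_
    rw [Fintype.range_linearCombination, Fintype.range_linearCombination]
    have h1 (p : ι → W) : Submodule.span F (Set.range fun r : {r // c r = i} => (N i).mkQ (p r)) =
        Submodule.map (N i).mkQ (N i ⊔ Submodule.span F (p '' {r | c r = i})) := by
      rw [Submodule.map_sup, Submodule.mkQ_map_self, bot_sup_eq, Submodule.map_span,
        Set.image_image, Set.image_eq_range]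
      rfl
    rw [h1, h1, h]
  choose e he using key
  let M : Matrix ι ι F := fun r s =>
    if hs : c s = c r then e (c r) (Pi.single ⟨r, rfl⟩ 1) ⟨s, hs⟩ else 0
  have hMe (i : ℕ) (r s : ι) (hr : c r = i) (hs : c s = i) :
      M r s = e i (Pi.single ⟨r, hr⟩ 1) ⟨s, hs⟩ := by
    subst hr
    exact dif_pos hs
  have hM : IsUnit M := by
    rw [← Matrix.vecMul_injective_iff_isUnit]
    refine (injective_iff_map_eq_zero M.vecMulLinear).2 fun a ha => ?_
    have h1 (i : ℕ) : e i (fun r => a r) = 0 := by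
      ext ⟨s, rfl⟩
      have h2 := congrFun ha s
      have h3 : (fun r : {r // c r = c s} => a r) =
          ∑ r : {r // c r = c s}, a r • Pi.single r (1 : F) := pi_eq_sum_univ' _
      rw [h3, map_sum, Finset.sum_apply]
      refine Eq.trans (Eq.symm ?_) h2
      refine (Fintype.sum_eq_sum_subtype (c · = c s) _ fun r hr => ?_).trans
        (Finset.sum_congr rfl fun r _ => ?_)
      · simp [M, Ne.symm hr]
      · obtain ⟨r, hr⟩ := r
        rw [map_smul]
        exact congrArg (a r * ·) (hMe (c s) r s hr rfl)
    ext r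
    have := (e (c r)).map_eq_zero_iff.1 (h1 (c r))
    exact congrFun this ⟨r, rfl⟩
  refine ⟨hM.unit, fun r s hrs => dif_neg (Ne.symm hrs), fun r => ?_⟩
  have h1 := he (c r) (Pi.single ⟨r, rfl⟩ 1)
  rw [Fintype.linearCombination_apply_single, one_smul, Fintype.linearCombination_apply] at h1
  rw [← Submodule.Quotient.mk_eq_zero, Submodule.Quotient.mk_sub, sub_eq_zero]
  refine Eq.trans ?_ h1
  change (N (c r)).mkQ (∑ s, M r s • p s) = _
  rw [map_sum]
  refine (Fintype.sum_eq_sum_subtype (c · = c r) _ fun s hs => ?_).trans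
    (Finset.sum_congr rfl fun s _ => ?_)
  · simp [M, hs]
  · simp [M, s.2]

theorem exists_unitriangular_smul_eq (c : ι → ℕ) (x y : ι → V)
    (h : ∀ r, y r - x r ∈ Submodule.span F (x '' {s | c r < c s})) :
    ∃ u : GL ι F, (∀ r s, c s ≤ c r → u.1 r s = if r = s then 1 else 0) ∧ u.1 • x = y := by
  have key (r : ι) : ∃ a : ι → F, (∀ s, c s ≤ c r → a s = 0) ∧ ∑ s, a s • x s = y r - x r := by
    obtain ⟨l, hl, hl'⟩ := (Finsupp.mem_span_image_iff_linearCombination F).1 (h r)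
    refine ⟨l, fun s hs => ?_, ?_⟩
    · by_contra h
      exact absurd (hl (Finsupp.mem_support_iff.2 h)) (not_lt.2 hs)
    · rw [← hl', Finsupp.linearCombination_apply, Finsupp.sum_fintype _ _ (by simp)]
  choose a ha ha' using key
  let M : Matrix ι ι F := 1 + Matrix.of a
  have hM' (r s : ι) (hrs : c s ≤ c r) : M r s = if r = s then 1 else 0 := by
    simp [M, ha r s hrs, Matrix.one_apply]
  have hM : IsUnit M := by
    have h1 : M.BlockTriangular c := fun r s hrs => by
      rw [hM' r s hrs.le, if_neg]
      rintro rfl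
      exact lt_irrefl _ hrs
    rw [Matrix.isUnit_iff_isUnit_det, h1.det, Finset.prod_eq_one]
    · exact isUnit_one
    intro i _
    rw [← Matrix.det_one (n := {r // c r = i})]
    congr 1
    ext ⟨r, hr⟩ ⟨s, hs⟩
    rw [Matrix.toSquareBlock_def, Matrix.of_apply, hM' r s (by omega), Matrix.one_apply]
    simp
  refine ⟨hM.unit, hM', funext fun r => ?_⟩
  change ∑ s, M r s • x s = y r
  simp [M, Matrix.one_apply, add_smul, Finset.sum_add_distrib, ha']

/-- The subspace spanned by the vectors of the family `x` in the blocks `≥ i`. -/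
def tailSpan (F : Type*) [Field F] {V ι : Type*} [AddCommGroup V] [Module F V] (c : ι → ℕ)
    (x : ι → V) (i : ℕ) : Submodule F V :=
  Submodule.span F (x '' {r | i ≤ c r})

theorem tailSpan_smul_le (c : ι → ℕ) (g : Matrix ι ι F) (hg : ∀ r s, c s < c r → g r s = 0)
    (x : ι → V) (i : ℕ) : tailSpan F c (g • x) i ≤ tailSpan F c x i := by
  rw [tailSpan, Submodule.span_le]
  rintro _ ⟨r, hr, rfl⟩
  refine Submodule.sum_mem _ fun s _ => ?_
  by_cases h : c s < c r
  · rw [hg r s h, zero_smul]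
    exact Submodule.zero_mem _
  · exact Submodule.smul_mem _ _
      (Submodule.subset_span ⟨s, le_trans (show i ≤ c r from hr) (not_lt.1 h), rfl⟩)

theorem tailSpan_smul (c : ι → ℕ) (g : GL ι F) (hg : ∀ r s, c s < c r → g.1 r s = 0)
    (hg' : ∀ r s, c s < c r → (g⁻¹).1 r s = 0) (x : ι → V) :
    tailSpan F c (g • x) = tailSpan F c x := by
  refine funext fun i => le_antisymm (tailSpan_smul_le c g.1 hg x i) ?_
  have := tailSpan_smul_le c (g⁻¹).1 hg' (g.1 • x) i
  rwa [← mul_smul, ← Units.val_mul, inv_mul_cancel, Units.val_one, one_smul] at this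

end BlockMatrices

section PairCodes

variable {F V ι : Type*} [Field F] [AddCommGroup V] [Module F V]

theorem tailSpan_anti (c : ι → ℕ) (x : ι → V) : Antitone (tailSpan F c x) := fun _ _ h =>
  Submodule.span_mono (Set.image_mono fun _ hr => le_trans h hr)

theorem tailSpan_eq_sup (c : ι → ℕ) (x : ι → V) (i : ℕ) :
    tailSpan F c x i = tailSpan F c x (i + 1) ⊔ Submodule.span F (x '' {r | c r = i}) := by
  rw [tailSpan, tailSpan, ← Submodule.span_union, ← Set.image_union]
  congr 2
  ext r
  simp only [Set.mem_ofPred_eq, Set.mem_union]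
  omega

/-- The subspace of `V × V` spanned by the pairs `(x r, y r)` with `r` in the block `i`, modulo the
square of the span of the later vectors of `x`. -/
def pairSpan (F : Type*) [Field F] {V ι : Type*} [AddCommGroup V] [Module F V] (c : ι → ℕ)
    (x y : ι → V) (i : ℕ) : Submodule F (V × V) :=
  (tailSpan F c x (i + 1)).prod (tailSpan F c x (i + 1)) ⊔
    Submodule.span F ((fun r => (x r, y r)) '' {r | c r = i})

theorem map_fst_pairSpan (c : ι → ℕ) (x y : ι → V) (i : ℕ) :
    (pairSpan F c x y i).map (LinearMap.fst F V V) = tailSpan F c x i := by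
  rw [pairSpan, Submodule.map_sup, Submodule.prod_map_fst, Submodule.map_span, Set.image_image,
    tailSpan_eq_sup c x i]
  rfl

theorem pairSpan_le {c : ι → ℕ} {x y : ι → V} (h : tailSpan F c x = tailSpan F c y) (i : ℕ) :
    pairSpan F c x y i ≤ (tailSpan F c x i).prod (tailSpan F c x i) := by
  refine sup_le (Submodule.prod_mono (tailSpan_anti c x i.le_succ) (tailSpan_anti c x i.le_succ)) ?_
  rw [Submodule.span_le]
  rintro _ ⟨r, hr, rfl⟩
  refine ⟨Submodule.subset_span ⟨r, (show c r = i from hr).ge, rfl⟩, ?_⟩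
  rw [h]
  exact Submodule.subset_span ⟨r, (show c r = i from hr).ge, rfl⟩

/-- The span of the vectors of a labelled list of pairs with label `i`. -/
def labelSpan (F : Type*) [Field F] {W κ : Type*} [AddCommGroup W] [Module F W] {t : ℕ}
    (k : κ → (Fin 2 → W) × Fin t) (i : Fin t) : Submodule F W :=
  Submodule.span F {w | ∃ a ε, (k a).2 = i ∧ (k a).1 ε = w}

theorem finrank_prod_self [FiniteDimensional F V] (A : Submodule F V) :
    Module.finrank F (A.prod A) = 2 * Module.finrank F A := by
  let e : A.prod A ≃ₗ[F] A × A :=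
    { toFun := fun w => (⟨w.1.1, w.2.1⟩, ⟨w.1.2, w.2.2⟩)
      invFun := fun w => ⟨(w.1, w.2), w.1.2, w.2.2⟩
      map_add' := fun _ _ => rfl
      map_smul' := fun _ _ => rfl
      left_inv := fun _ => rfl
      right_inv := fun _ => rfl }
  rw [e.finrank_eq, Module.finrank_prod, two_mul]

theorem exists_labelSpan_eq_pairSpan [FiniteDimensional F V] {t j : ℕ} [NeZero t] (c : ι → ℕ)
    (hj : Module.finrank F V ≤ j) (x y : ι → V) (h : tailSpan F c x = tailSpan F c y) :
    ∃ k : Fin j → (Fin 2 → V × V) × Fin t, ∀ i : Fin t, pairSpan F c x y i =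
      (tailSpan F c x (i + 1)).prod (tailSpan F c x (i + 1)) ⊔ labelSpan F k i := by
  let d (i : ℕ) := Module.finrank F (tailSpan F c x i)
  have hd (i : ℕ) : d (i + 1) ≤ d i := Submodule.finrank_mono (tailSpan_anti c x i.le_succ)
  have hsum (t : ℕ) : ∑ i ∈ Finset.range t, (d i - d (i + 1)) + d t = d 0 := by
    induction t with
    | zero => simp
    | succ t ih =>
      have := hd t
      rw [Finset.sum_range_succ]
      omega
  obtain ⟨e⟩ : Nonempty ((Σ i : Fin t, Fin (d i - d (i + 1))) ↪ Fin j) := by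
    refine Function.Embedding.nonempty_of_card_le ?_
    rw [Fintype.card_sigma]
    simp only [Fintype.card_fin]
    rw [Fin.sum_univ_eq_sum_range (fun i => d i - d (i + 1))]
    have h1 := hsum t
    have h2 : d 0 ≤ Module.finrank F V := Submodule.finrank_le _
    omega
  have hw (i : Fin t) : ∃ w : Fin (d i - d (i + 1)) × Fin 2 → V × V,
      (tailSpan F c x (i + 1)).prod (tailSpan F c x (i + 1)) ⊔ Submodule.span F (Set.range w) =
        pairSpan F c x y i := by
    refine Submodule.exists_sup_span_range_eq le_sup_left ?_
    refine (Submodule.finrank_mono (pairSpan_le h i)).trans ?_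
    rw [finrank_prod_self, finrank_prod_self, Fintype.card_prod, Fintype.card_fin, Fintype.card_fin]
    have := hd i
    simp only [d] at this ⊢
    omega
  choose w hw using hw
  let k : Fin j → (Fin 2 → V × V) × Fin t :=
    Function.extend e (fun p => (fun ε => w p.1 (p.2, ε), p.1)) fun _ => (0, 0)
  have hk (p) : k (e p) = (fun ε => w p.1 (p.2, ε), p.1) := e.injective.extend_apply _ _ p
  refine ⟨k, fun i => ?_⟩
  rw [← hw]
  congr 1
  refine le_antisymm (Submodule.span_mono ?_) (Submodule.span_le.2 ?_)
  · rintro _ ⟨⟨s, ε⟩, rfl⟩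
    exact ⟨e ⟨i, s⟩, ε, by rw [hk], by rw [hk]⟩
  · rintro _ ⟨a, ε, rfl, rfl⟩
    by_cases ha : ∃ p, e p = a
    · obtain ⟨p, rfl⟩ := ha
      rw [hk]
      exact Submodule.subset_span ⟨(p.2, ε), rfl⟩
    · have : k a = (0, 0) := Function.extend_apply' _ _ _ ha
      simp [this]

theorem pairSpan_eq_of_labelSpan {t : ℕ} {κ : Type*} {c : ι → ℕ} (hc : ∀ r, c r < t)
    (k : κ → (Fin 2 → V × V) × Fin t) {x y x' y' : ι → V}
    (h : ∀ i : Fin t, pairSpan F c x y i =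
      (tailSpan F c x (i + 1)).prod (tailSpan F c x (i + 1)) ⊔ labelSpan F k i)
    (h' : ∀ i : Fin t, pairSpan F c x' y' i =
      (tailSpan F c x' (i + 1)).prod (tailSpan F c x' (i + 1)) ⊔ labelSpan F k i) :
    tailSpan F c x = tailSpan F c x' ∧ pairSpan F c x y = pairSpan F c x' y' := by
  have h0 (x : ι → V) (i : ℕ) (hi : t ≤ i) : tailSpan F c x i = ⊥ := by
    rw [tailSpan, Submodule.span_eq_bot]
    rintro _ ⟨r, hr, rfl⟩
    exact absurd ((hi.trans hr).trans_lt (hc r)) (lt_irrefl _)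
  have h1 (n : ℕ) : ∀ i, t ≤ i + n → tailSpan F c x i = tailSpan F c x' i := by
    induction n with
    | zero => exact fun i hi => (h0 x i hi).trans (h0 x' i hi).symm
    | succ n ih =>
      intro i hi
      by_cases hit : t ≤ i
      · exact (h0 x i hit).trans (h0 x' i hit).symm
      · have h2 := h ⟨i, not_le.1 hit⟩
        have h3 := h' ⟨i, not_le.1 hit⟩
        rw [← map_fst_pairSpan c x y, ← map_fst_pairSpan c x' y']
        dsimp only at h2 h3
        rw [h2, h3, ih (i + 1) (by omega)]
  have h2 : tailSpan F c x = tailSpan F c x' := funext fun i => h1 t i (Nat.le_add_left t i)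
  refine ⟨h2, funext fun i => ?_⟩
  by_cases hit : t ≤ i
  · have h3 : {r | c r = i} = ∅ := by
      ext r
      have := hc r
      simp only [Set.mem_ofPred_eq, Set.mem_empty_iff_false, iff_false]
      omega
    rw [pairSpan, pairSpan, h2, h3, Set.image_empty, Set.image_empty]
  · have h3 := h ⟨i, not_le.1 hit⟩
    have h4 := h' ⟨i, not_le.1 hit⟩
    dsimp only at h3 h4
    rw [h3, h4, h2]

end PairCodes

section LeviRestriction

open scoped Matrix.Module

theorem le_normalizer_of_blocks {F ι : Type*} [Field F] [Fintype ι] [DecidableEq ι] {c : ι → ℕ}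
    {L U : Subgroup (GL ι F)} (hL : ∀ g, g ∈ L ↔ ∀ r s, c r ≠ c s → g.1 r s = 0)
    (hU : ∀ g, g ∈ U ↔ ∀ r s, c s ≤ c r → g.1 r s = if r = s then 1 else 0) :
    L ≤ Subgroup.normalizer (U : Set (GL ι F)) := by
  have key (l : GL ι F) (hl : l ∈ L) (u : GL ι F) (hu : u ∈ U) : l * u * l⁻¹ ∈ U := by
    have hU' (g : GL ι F) : g ∈ U ↔ ∀ r s, c s ≤ c r → (g.1 - 1) r s = 0 := by
      simp only [hU, Matrix.sub_apply, Matrix.one_apply, sub_eq_zero]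
    have hl' := (hL _).1 (inv_mem hl)
    rw [hL] at hl
    rw [hU'] at hu ⊢
    intro r s hrs
    have h1 : (l * u * l⁻¹).1 - 1 = l.1 * (u.1 - 1) * (l⁻¹).1 := by
      rw [mul_sub, sub_mul, mul_one, ← Units.val_mul, ← Units.val_mul, ← Units.val_mul,
        mul_inv_cancel, Units.val_one]
    rw [h1, Matrix.mul_apply]
    refine Finset.sum_eq_zero fun a _ => ?_
    by_cases ha : c a = c s
    · rw [Matrix.mul_apply, Finset.sum_eq_zero, zero_mul]
      intro a' _
      by_cases ha' : c r = c a'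
      · rw [hu a' a (by omega), mul_zero]
      · rw [hl r a' ha', zero_mul]
    · rw [hl' a s ha, mul_zero]
  intro l hl
  rw [Subgroup.mem_normalizer_iff]
  refine fun u => ⟨key l hl u, fun hu => ?_⟩
  have := key l⁻¹ (inv_mem hl) _ hu
  simpa [mul_assoc] using this

variable {F V ι : Type} [Field F] [AddCommGroup V] [Module F V] [Fintype ι] [DecidableEq ι]

theorem exists_levi_unipotent_smul_eq {c : ι → ℕ} {L U : Subgroup (GL ι F)}
    (hL : ∀ g, g ∈ L ↔ ∀ r s, c r ≠ c s → g.1 r s = 0)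
    (hU : ∀ g, g ∈ U ↔ ∀ r s, c s ≤ c r → g.1 r s = if r = s then 1 else 0) {x x' y y' : ι → V}
    (hx : tailSpan F c x = tailSpan F c x') (hxy : tailSpan F c x = tailSpan F c y)
    (h : pairSpan F c x x' = pairSpan F c y y') :
    ∃ l ∈ L, ∃ u ∈ U, ∃ u' ∈ U, u • l • x = y ∧ u' • l • x' = y' := by
  obtain ⟨l, hl, hlp⟩ := exists_blockDiagonal_smul_sub_mem c (fun r => (x r, x' r))
    (fun r => (y r, y' r)) (fun i => (tailSpan F c x (i + 1)).prod (tailSpan F c x (i + 1)))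
    fun i => by
      have := congrFun h i
      rw [pairSpan, pairSpan, ← hxy] at this
      exact this
  have hlL : l ∈ L := (hL l).2 hl
  have hl' := (hL _).1 (inv_mem hlL)
  have htail (x : ι → V) : tailSpan F c (l • x) = tailSpan F c x :=
    tailSpan_smul c l (fun r s hrs => hl r s hrs.ne') (fun r s hrs => hl' r s hrs.ne') x
  obtain ⟨u, hu, hux⟩ := exists_unitriangular_smul_eq c (l • x) y fun r => by
    change _ ∈ tailSpan F c (l • x) (c r + 1)
    rw [htail, ← neg_mem_iff, neg_sub]
    have h1 := (hlp r).1
    change (∑ s, l.1 r s • (x s, x' s)).1 - y r ∈ _ at h1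
    rw [Prod.fst_sum] at h1
    exact h1
  obtain ⟨u', hu', hux'⟩ := exists_unitriangular_smul_eq c (l • x') y' fun r => by
    change _ ∈ tailSpan F c (l • x') (c r + 1)
    rw [htail, ← hx, ← neg_mem_iff, neg_sub]
    have h1 := (hlp r).2
    change (∑ s, l.1 r s • (x s, x' s)).2 - y' r ∈ _ at h1
    rw [Prod.snd_sum] at h1
    exact h1
  exact ⟨l, hlL, u, (hU u).2 hu, u', (hU u').2 hu', hux, hux'⟩

theorem sum_charInner_levi_le [Finite F] [Finite V] {c : ι → ℕ} {t j : ℕ} [NeZero t]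
    (hc : ∀ r, c r < t) (hj : Module.finrank F V ≤ j) {L U : Subgroup (GL ι F)}
    (hL : ∀ g, g ∈ L ↔ ∀ r s, c r ≠ c s → g.1 r s = 0)
    (hU : ∀ g, g ∈ U ↔ ∀ r s, c s ≤ c r → g.1 r s = if r = s then 1 else 0)
    (χ : GL ι F → ℂ) (hχ : IsIrredCharacter χ)
    (hX : charInner (GL ι F) χ (fun g => (Nat.card (MulAction.fixedBy (ι → V) g) : ℂ)) ≠ 0)
    (S : Finset (L → ℂ)) (hS : ∀ η ∈ S, IsIrredCharacter η) :
    ∑ η ∈ S, charInner L η (fun l : L => (Nat.card U : ℂ)⁻¹ * ∑ᶠ u : U, χ (l * u)) ≤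
      Nat.card (Fin j → (Fin 2 → V × V) × Fin t) := by
  let R (x : ι → V) : Set.range (tailSpan F c : (ι → V) → ℕ → Submodule F V) :=
    ⟨tailSpan F c x, x, rfl⟩
  have hR {x y : ι → V} (h : R x = R y) : tailSpan F c x = tailSpan F c y := congrArg Subtype.val h
  have hRL (g : GL ι F) (hg : g ∈ L) (x : ι → V) : R (g • x) = R x :=
    Subtype.ext <| tailSpan_smul c g (fun r s hrs => (hL g).1 hg r s hrs.ne')
      (fun r s hrs => (hL _).1 (inv_mem hg) r s hrs.ne') x
  have hRU (g : GL ι F) (hg : g ∈ U) (x : ι → V) : R (g • x) = R x := by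
    have h1 (g : GL ι F) (hg : g ∈ U) (r s : ι) (hrs : c s < c r) : g.1 r s = 0 := by
      rw [(hU g).1 hg r s hrs.le, if_neg]
      rintro rfl
      exact lt_irrefl _ hrs
    exact Subtype.ext <| tailSpan_smul c g (h1 g hg) (h1 _ (inv_mem hg)) x
  have hcode (z : {z : (ι → V) × (ι → V) // R z.1 = R z.2}) :=
    exists_labelSpan_eq_pairSpan (t := t) c hj z.1.1 z.1.2 (hR z.2)
  choose code hcode using hcode
  refine sum_charInner_average_le L U (le_normalizer_of_blocks hL hU) χ hχ hX R hRL hRU code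
    (fun z z' hz => ?_) S hS
  have h1 := hcode z
  rw [hz] at h1
  obtain ⟨h2, h3⟩ := pairSpan_eq_of_labelSpan hc _ h1 (hcode z')
  exact exists_levi_unipotent_smul_eq hL hU (hR z.2) h2 h3

theorem permChar_pow [Fintype F] (n j : ℕ) (g : GL (Fin n) F) :
    permChar F n g ^ j = Nat.card (MulAction.fixedBy (Fin n → Fin j → F) g) := by
  rw [permChar, ← Nat.cast_pow, Nat.cast_inj]
  let e : MulAction.fixedBy (Fin n → Fin j → F) g ≃
      (Fin j → {v : Fin n → F // g.1.mulVec v = v}) :=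
    { toFun := fun x k => ⟨fun r => x.1 r k, funext fun r => by
        have := congrFun (congrFun x.2 r) k
        refine Eq.trans ?_ this
        change _ = (∑ s, g.1 r s • x.1 s) k
        rw [Finset.sum_apply]
        rfl⟩
      invFun := fun v => ⟨fun r k => (v k).1 r, funext fun r => funext fun k => by
        refine Eq.trans ?_ (congrFun (v k).2 r)
        change (∑ s, g.1 r s • fun k => (v k).1 s) k = _
        rw [Finset.sum_apply]
        rfl⟩
      left_inv := fun _ => rfl
      right_inv := fun _ => rfl }
  rw [Nat.card_congr e, Nat.card_fun, Nat.card_eq_fintype_card (α := Fin j), Fintype.card_fin]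

end LeviRestriction

theorem stmt_6 (q n t j : ℕ) (hq : IsPrimePow q) (hn : 0 < n)
    (F : Type) [Field F] [Fintype F] (hF : Fintype.card F = q)
    (χ : GL (Fin n) F → ℂ) (hχ : IsIrredCharacter χ)
    -- `j` is the true level of `χ` : the least `j'` with `⟨χ, τ^{j'}⟩ ≠ 0`
    (hlevel : IsLeast {j' : ℕ |
      charInner (GL (Fin n) F) χ (fun x => permChar F n x ^ j') ≠ 0} j)
    (hj : 2 * j ≤ n)
    (ht : 2 ≤ t) (m : Fin t → ℕ) (hm : ∀ i, 1 ≤ m i) (hsum : ∑ i, m i = n)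
    -- `b` assigns to each index its block, the `k`-th block having size `m k`
    (b : Fin n → Fin t) (hb : Monotone b)
    (hbm : ∀ k : Fin t, Nat.card {i : Fin n // b i = k} = m k)
    -- `L` is the block-diagonal Levi subgroup `GL_{m_1} × ⋯ × GL_{m_t}`
    (L : Subgroup (GL (Fin n) F))
    (hL : ∀ x : GL (Fin n) F, x ∈ L ↔
      ∀ i i' : Fin n, b i ≠ b i' → (x : Matrix (Fin n) (Fin n) F) i i' = 0)
    -- `U` is the group of block upper unitriangular matrices
    (U : Subgroup (GL (Fin n) F))
    (hU : ∀ x : GL (Fin n) F, x ∈ U ↔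
      ∀ i i' : Fin n, b i' ≤ b i →
        (x : Matrix (Fin n) (Fin n) F) i i' = if i = i' then 1 else 0) :
    (∑ᶠ η ∈ {η : L → ℂ | IsIrredCharacter η},
        charInner L η (fun l : L =>
          (Nat.card U : ℂ)⁻¹ * ∑ᶠ u : U, χ ((l : GL (Fin n) F) * (u : GL (Fin n) F)))) ≤
      (n : ℂ) ^ j * (Nat.factorial j : ℂ) ^ 2 * (q : ℂ) ^ (4 * j ^ 2) := by
  have : NeZero t := ⟨by omega⟩
  have hX := hlevel.1
  simp only [Set.mem_ofPred_eq, permChar_pow] at hX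
  have hL' (g : GL (Fin n) F) : g ∈ L ↔ ∀ r s, (b r : ℕ) ≠ b s → g.1 r s = 0 := by
    simp only [hL, ne_eq, Fin.ext_iff]
  have hS (S : Finset (L → ℂ)) (hS : ∀ η ∈ S, IsIrredCharacter η) :=
    sum_charInner_levi_le (c := fun r => (b r : ℕ)) (t := t) (j := j) (V := Fin j → F)
      (fun r => (b r).2) (by simp) hL' hU χ hχ hX S hS
  have htn : t ≤ n := by
    calc t = ∑ _ : Fin t, 1 := by simp
      _ ≤ ∑ i, m i := Finset.sum_le_sum fun i _ => hm i
      _ = n := hsum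
  have hcard : Nat.card (Fin j → (Fin 2 → (Fin j → F) × (Fin j → F)) × Fin t) =
      t ^ j * q ^ (4 * j ^ 2) := by
    simp only [Nat.card_eq_fintype_card, Fintype.card_fun, Fintype.card_prod, Fintype.card_fin, hF]
    ring
  have hbound : (Nat.card (Fin j → (Fin 2 → (Fin j → F) × (Fin j → F)) × Fin t) : ℂ) ≤
      (n : ℂ) ^ j * (Nat.factorial j : ℂ) ^ 2 * (q : ℂ) ^ (4 * j ^ 2) := by
    have h1 : 1 ≤ Nat.factorial j ^ 2 := Nat.one_le_pow _ _ (Nat.factorial_pos j)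
    have h2 : t ^ j * q ^ (4 * j ^ 2) ≤ n ^ j * Nat.factorial j ^ 2 * q ^ (4 * j ^ 2) :=
      Nat.mul_le_mul_right _
        ((Nat.pow_le_pow_left htn j).trans (Nat.le_mul_of_pos_right _ h1))
    rw [hcard]
    exact_mod_cast h2
  refine le_trans ?_ hbound
  by_cases hfin : ({η : L → ℂ | IsIrredCharacter η} ∩ Function.support fun η =>
      charInner L η (fun l : L => (Nat.card U : ℂ)⁻¹ * ∑ᶠ u : U, χ (l * u))).Finite
  · rw [finsum_mem_eq_sum _ hfin]
    exact hS _ fun η hη => ((Set.Finite.mem_toFinset _).1 hη).1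
  · rw [finsum_mem_eq_zero_of_infinite hfin]
    exact Nat.cast_nonneg _
end

section
/- Let 𝒢 be a group and F an automorphism of 𝒢 such that the Lang map g ↦ g^{−1}·F(g) is surjective from 𝒢 onto 𝒢. Form the semidirect product 𝒢 ⋊ ⟨F⟩ in which the infinite cyclic group ⟨F⟩ acts on 𝒢 via F (so FgF^{−1} = F(g)), let 𝒢F denote the coset {gF : g ∈ 𝒢}, and let 𝒞(𝒢F) := {(g,n) ∈ 𝒢 × 𝒢F : gn = ng}, on which 𝒢 acts by simultaneous conjugation. Then the map sending the conjugacy class of g in the fixed-point subgroup C_𝒢(F) = {g ∈ 𝒢 : F(g) = g} to the 𝒢-orbit of the pair (g, F) is a well-defined bijection from the set of conjugacy classes of C_𝒢(F) onto the set of 𝒢-orbits on 𝒞(𝒢F). -/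
/-- The semidirect product `𝒢 ⋊ ⟨F⟩`, where the infinite cyclic group `⟨F⟩`
(modelled as `Multiplicative ℤ`) acts on `𝒢` via the automorphism `F`. -/
abbrev LangSDP {𝒢 : Type*} [Group 𝒢] (F : MulAut 𝒢) : Type _ :=
  𝒢 ⋊[zpowersHom (MulAut 𝒢) F] Multiplicative ℤ

/-- The element `F` of `𝒢 ⋊ ⟨F⟩`. -/
def frobEl {𝒢 : Type*} [Group 𝒢] (F : MulAut 𝒢) : LangSDP F :=
  SemidirectProduct.inr (Multiplicative.ofAdd 1)

/-- The canonical copy of `g ∈ 𝒢` inside `𝒢 ⋊ ⟨F⟩`. -/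
def inG {𝒢 : Type*} [Group 𝒢] (F : MulAut 𝒢) (g : 𝒢) : LangSDP F :=
  SemidirectProduct.inl g

/-- Two pairs in `𝒢 × (𝒢 ⋊ ⟨F⟩)` lie in the same orbit of the simultaneous
conjugation action of `𝒢`. -/
def sameOrbit {𝒢 : Type*} [Group 𝒢] (F : MulAut 𝒢)
    (p p' : 𝒢 × LangSDP F) : Prop :=
  ∃ h : 𝒢, p'.1 = h * p.1 * h⁻¹ ∧ p'.2 = inG F h * p.2 * (inG F h)⁻¹

/-- `(g, m)` is a commuting pair with `m` in the coset `𝒢F ⊆ 𝒢 ⋊ ⟨F⟩`. -/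
def IsCommutingPair {𝒢 : Type*} [Group 𝒢] (F : MulAut 𝒢)
    (p : 𝒢 × LangSDP F) : Prop :=
  (∃ a : 𝒢, p.2 = inG F a * frobEl F) ∧ inG F p.1 * p.2 = p.2 * inG F p.1

section LangCoset

variable {𝒢 : Type*} [Group 𝒢] (F : MulAut 𝒢)

theorem inG_mul (a b : 𝒢) : inG F (a * b) = inG F a * inG F b :=
  map_mul SemidirectProduct.inl a b

theorem inG_inv (a : 𝒢) : inG F a⁻¹ = (inG F a)⁻¹ :=
  map_inv SemidirectProduct.inl a

theorem inG_injective : Function.Injective (inG F) :=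
  SemidirectProduct.inl_injective

theorem frobEl_mul_inG (g : 𝒢) : frobEl F * inG F g = inG F (F g) * frobEl F := by
  ext <;> simp [frobEl, inG]

theorem conj_frobEl (h : 𝒢) :
    inG F h * frobEl F * (inG F h)⁻¹ = inG F (h * (F h)⁻¹) * frobEl F := by
  rw [← inG_inv, mul_assoc, frobEl_mul_inG, map_inv, inG_mul, mul_assoc]

theorem conj_frobEl_eq_iff (h : 𝒢) :
    frobEl F = inG F h * frobEl F * (inG F h)⁻¹ ↔ F h = h := by
  rw [eq_mul_inv_iff_mul_eq, frobEl_mul_inG, mul_left_inj, (inG_injective F).eq_iff]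

theorem inG_comm_coset_iff (g a : 𝒢) :
    inG F g * (inG F a * frobEl F) = inG F a * frobEl F * inG F g ↔ g * a = a * F g := by
  rw [mul_assoc (inG F a), frobEl_mul_inG, ← mul_assoc, ← mul_assoc, mul_left_inj,
    ← inG_mul, ← inG_mul, (inG_injective F).eq_iff]

end LangCoset

theorem stmt_9 {𝒢 : Type*} [Group 𝒢] (F : MulAut 𝒢)
    (hLang : ∀ h : 𝒢, ∃ g : 𝒢, g⁻¹ * F g = h) :
    -- the map is well defined into commuting pairs …
    (∀ g : 𝒢, F g = g → IsCommutingPair F (g, frobEl F)) ∧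
    -- … it identifies conjugacy in `C_𝒢(F)` with simultaneous `𝒢`-conjugacy
    -- (well-definedness on classes together with injectivity) …
    (∀ g g' : 𝒢, F g = g → F g' = g' →
      ((∃ h : 𝒢, F h = h ∧ g' = h * g * h⁻¹) ↔
        sameOrbit F (g, frobEl F) (g', frobEl F))) ∧
    -- … and it is surjective onto the `𝒢`-orbits of commuting pairs.
    (∀ p : 𝒢 × LangSDP F, IsCommutingPair F p →
      ∃ g : 𝒢, F g = g ∧ sameOrbit F (g, frobEl F) p) := by
  refine ⟨fun g hg => ⟨⟨1, by simp [inG]⟩, ?_⟩, fun g g' _ _ => ?_, ?_⟩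
  · change inG F g * frobEl F = frobEl F * inG F g
    rw [frobEl_mul_inG, hg]
  · exact exists_congr fun h => by rw [conj_frobEl_eq_iff, and_comm]
  · rintro ⟨x, m⟩ ⟨⟨a, rfl : m = _⟩, hcomm⟩
    have hx : x * a = a * F x := (inG_comm_coset_iff F x a).1 hcomm
    obtain ⟨u, rfl⟩ := hLang a
    refine ⟨u * x * u⁻¹, ?_, u⁻¹, by group, ?_⟩
    · have hFx : F x = (u⁻¹ * F u)⁻¹ * (x * (u⁻¹ * F u)) := by rw [hx]; group
      rw [map_mul, map_mul, map_inv, hFx]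
      group
    · change inG F (u⁻¹ * F u) * frobEl F = inG F u⁻¹ * frobEl F * (inG F u⁻¹)⁻¹
      rw [conj_frobEl, map_inv, inv_inv]
end

section
/- Let a ≥ 2 be an integer. For every ε > 0 there exists N = N(a, ε) such that for every prime power q with gcd(q,a) = 1, every integer n > N, and every k ∈ ℤ/aℤ, one has | j_{q,n,k}(a) · q^{−(1−1/a)·n²} − C_{q,n,k}(a) | < ε, where C_{q,n,k}(a) := [ ∏_{j=1}^∞ (1 − q^{−j}) / ∏_{s ∈ S} ∏_{j=1}^∞ (1 − q^{−l_s·j}) ] · Σ_m q^{−Σ_{i ∈ ℤ/aℤ} (m_i − n/a)²}, the sum being over all functions m : ℤ/aℤ → ℤ satisfying m_{q·i} = m_i for all i ∈ ℤ/aℤ, Σ_i m_i = n, and Σ_i i·m_i ≡ k (mod a); here S is a set of representatives for the orbits of multiplication by q on ℤ/aℤ and l_s is the size of the orbit of s. -/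
open scoped MatrixGroups

/-- `S` is a set of representatives for the orbits of multiplication by `q` on `ℤ/aℤ`. -/
def IsOrbitRepSet (a q : ℕ) (S : Finset (ZMod a)) : Prop :=
  ∀ i : ZMod a, ∃! s, s ∈ S ∧ ∃ e : ℕ, (q : ZMod a) ^ e * s = i

/-- The size `l_s` of the orbit of `s` under multiplication by `q` on `ℤ/aℤ`. -/
noncomputable def orbitSize (a q : ℕ) (s : ZMod a) : ℕ :=
  Nat.card {x : ZMod a // ∃ e : ℕ, (q : ZMod a) ^ e * s = x}

/-- The constant `C_{q,n,k}(a)`, relative to a set `S` of representatives of the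
orbits of multiplication by `q` on `ℤ/aℤ`. -/
noncomputable def Cconst (a q n : ℕ) (k : ZMod a) (S : Finset (ZMod a)) : ℝ :=
  ((∏' j : ℕ, (1 - (q : ℝ) ^ (-(j + 1 : ℝ)))) /
      ∏ s ∈ S, ∏' j : ℕ, (1 - (q : ℝ) ^ (-((orbitSize a q s : ℝ) * (j + 1 : ℝ))))) *
    ∑' m : {m : ZMod a → ℤ //
        (∀ i, m ((q : ZMod a) * i) = m i) ∧ (∑ᶠ i, m i) = (n : ℤ) ∧
        (∑ᶠ i : ZMod a, i * (m i : ZMod a)) = k},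
      (q : ℝ) ^ (-(∑ᶠ i : ZMod a, ((m.1 i : ℝ) - (n : ℝ) / (a : ℝ)) ^ 2))

/-- `j_{q,n,k}(a)`: the number of `t ∈ GL_n(F_q)` with `t^a = 1` and `det t = ζ^k`,
where `ζ` is a fixed primitive `a`-th root of unity in the algebraic closure. -/
noncomputable def jCount (a n : ℕ) (F : Type) [Field F] [Fintype F]
    (ζ : AlgebraicClosure F) (k : ZMod a) : ℕ :=
  Nat.card {t : GL (Fin n) F // t ^ a = 1 ∧
    algebraMap F (AlgebraicClosure F) ((t : Matrix (Fin n) (Fin n) F).det) = ζ ^ k.val}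

section QPochhammer

open Finset

/-- The finite `q`-Pochhammer product `∏_{j=1}^m (1 - Q^{-j})`. -/
noncomputable def qPoch (Q : ℝ) (m : ℕ) : ℝ := ∏ j ∈ range m, (1 - (Q⁻¹) ^ (j + 1))

/-- The infinite product `∏_{j≥1} (1 - Q^{-j})`. -/
noncomputable def qPochInf (Q : ℝ) : ℝ := ∏' j : ℕ, (1 - (Q⁻¹) ^ (j + 1))

lemma qPoch_succ (Q : ℝ) (m : ℕ) :
    qPoch Q (m + 1) = qPoch Q m * (1 - (Q⁻¹) ^ (m + 1)) := by
  simp [qPoch, prod_range_succ]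

lemma inv_pow_le_half_pow {Q : ℝ} (hQ : 2 ≤ Q) (j : ℕ) : (Q⁻¹) ^ j ≤ (1 / 2 : ℝ) ^ j := by
  have : Q⁻¹ ≤ 1 / 2 := by
    rw [one_div]; exact inv_anti₀ (by norm_num) hQ
  exact pow_le_pow_left₀ (by positivity) this j

lemma quarter_add_le_qPoch {Q : ℝ} (hQ : 2 ≤ Q) (m : ℕ) :
    1 / 4 + (1 / 2 : ℝ) ^ (m + 2) ≤ qPoch Q (m + 1) := by
  induction m with
  | zero =>
    have := inv_pow_le_half_pow hQ 1
    simp only [qPoch, zero_add, prod_range_one]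
    norm_num at this ⊢
    linarith
  | succ m ih =>
    rw [qPoch_succ]
    have h1 := inv_pow_le_half_pow hQ (m + 1 + 1)
    have h2 : (1 / 2 : ℝ) ^ (m + 2) ≤ 1 / 4 := by
      calc (1 / 2 : ℝ) ^ (m + 2) ≤ (1 / 2 : ℝ) ^ 2 :=
            pow_le_pow_of_le_one (by norm_num) (by norm_num) (by omega)
        _ = 1 / 4 := by norm_num
    have h3 : (0 : ℝ) < (1 / 2) ^ (m + 2) := by positivity
    have h4 : (1 / 2 : ℝ) ^ (m + 1 + 2) = (1 / 2) ^ (m + 2) / 2 := by ring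
    rw [h4]
    have h1' : (Q⁻¹) ^ (m + 1 + 1) ≤ (1 / 2 : ℝ) ^ (m + 2) := h1
    calc _ ≤ (1 / 4 + (1 / 2 : ℝ) ^ (m + 2)) * (1 - (1 / 2) ^ (m + 2)) := by nlinarith
      _ ≤ _ := mul_le_mul ih (by linarith) (by linarith) (by linarith)

lemma quarter_le_qPoch {Q : ℝ} (hQ : 2 ≤ Q) (m : ℕ) : 1 / 4 ≤ qPoch Q m := by
  cases m with
  | zero => norm_num [qPoch]
  | succ m =>
    have := quarter_add_le_qPoch hQ m
    have h3 : (0 : ℝ) < (1 / 2) ^ (m + 2) := by positivity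
    linarith

lemma qPoch_succ_le {Q : ℝ} (hQ : 2 ≤ Q) (m : ℕ) : qPoch Q (m + 1) ≤ qPoch Q m := by
  have := quarter_le_qPoch hQ m
  rw [qPoch_succ]
  have : 0 ≤ (Q⁻¹) ^ (m + 1) := by positivity
  nlinarith

lemma qPoch_antitone {Q : ℝ} (hQ : 2 ≤ Q) : Antitone (qPoch Q) :=
  antitone_nat_of_succ_le (qPoch_succ_le hQ)

lemma qPoch_le_one {Q : ℝ} (hQ : 2 ≤ Q) (m : ℕ) : qPoch Q m ≤ 1 := by
  simpa [qPoch] using qPoch_antitone hQ (Nat.zero_le m)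

lemma qPoch_sub_monotone {Q : ℝ} (hQ : 2 ≤ Q) :
    Antitone fun m ↦ (1 / 2 : ℝ) ^ m - qPoch Q m := by
  refine antitone_nat_of_succ_le fun m ↦ ?_
  have h1 := inv_pow_le_half_pow hQ (m + 1)
  have h2 := qPoch_le_one hQ m
  have h3 := quarter_le_qPoch hQ m
  have h4 : 0 ≤ (Q⁻¹) ^ (m + 1) := by positivity
  have h5 : (1 / 2 : ℝ) ^ m = 2 * (1 / 2) ^ (m + 1) := by ring
  rw [qPoch_succ, h5]
  nlinarith

lemma tendsto_qPoch {Q : ℝ} (hQ : 2 ≤ Q) :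
    Filter.Tendsto (qPoch Q) Filter.atTop (nhds (qPochInf Q)) := by
  have hs : Summable fun j : ℕ ↦ ‖-(Q⁻¹) ^ (j + 1)‖ := by
    refine Summable.of_nonneg_of_le (fun _ ↦ norm_nonneg _) (fun j ↦ ?_)
      ((summable_nat_add_iff 1).2 summable_geometric_two)
    rw [norm_neg, Real.norm_of_nonneg (by positivity)]
    exact inv_pow_le_half_pow hQ (j + 1)
  have := (multipliable_one_add_of_summable hs).hasProd.tendsto_prod_nat
  simp only [← sub_eq_add_neg] at this
  exact this

lemma quarter_le_qPochInf {Q : ℝ} (hQ : 2 ≤ Q) : 1 / 4 ≤ qPochInf Q :=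
  ge_of_tendsto' (tendsto_qPoch hQ) (quarter_le_qPoch hQ)

lemma qPochInf_le_qPoch {Q : ℝ} (hQ : 2 ≤ Q) (m : ℕ) : qPochInf Q ≤ qPoch Q m :=
  (qPoch_antitone hQ).le_of_tendsto (tendsto_qPoch hQ) m

lemma qPoch_sub_qPochInf_le {Q : ℝ} (hQ : 2 ≤ Q) (m : ℕ) :
    qPoch Q m - qPochInf Q ≤ (1 / 2 : ℝ) ^ m := by
  have h := ((tendsto_pow_atTop_nhds_zero_of_lt_one (r := (1 / 2 : ℝ)) (by norm_num)
    (by norm_num)).sub (tendsto_qPoch hQ))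
  have := (qPoch_sub_monotone hQ).le_of_tendsto h m
  linarith

/-- `1 / ∏_{j=1}^m (1 - Q^{-j})`, extended by `0` to negative `m`. -/
noncomputable def qPochInv (Q : ℝ) (m : ℤ) : ℝ := if 0 ≤ m then (qPoch Q m.toNat)⁻¹ else 0

lemma qPochInv_nonneg {Q : ℝ} (hQ : 2 ≤ Q) (m : ℤ) : 0 ≤ qPochInv Q m := by
  unfold qPochInv
  split_ifs
  · have := quarter_le_qPoch hQ m.toNat
    positivity
  · rfl

lemma inv_le_four {x : ℝ} (hx : 1 / 4 ≤ x) : x⁻¹ ≤ 4 := by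
  have := inv_anti₀ (by norm_num) hx
  norm_num at this
  exact this

lemma qPochInv_le {Q : ℝ} (hQ : 2 ≤ Q) (m : ℤ) : qPochInv Q m ≤ 4 := by
  unfold qPochInv
  split_ifs
  · exact inv_le_four (quarter_le_qPoch hQ _)
  · norm_num

lemma abs_qPochInv_sub_le {Q : ℝ} (hQ : 2 ≤ Q) (m : ℤ) :
    |qPochInv Q m - (qPochInf Q)⁻¹| ≤ 16 * (2 : ℝ) ^ (-(m : ℝ)) := by
  have hi := quarter_le_qPochInf hQ
  have hi4 := inv_le_four hi
  have hi0 : 0 < (qPochInf Q)⁻¹ := by positivity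
  unfold qPochInv
  split_ifs with h
  · obtain ⟨m, rfl⟩ := Int.eq_ofNat_of_zero_le h
    have h1 := quarter_le_qPoch hQ m
    have h2 := qPochInf_le_qPoch hQ m
    have h3 := qPoch_sub_qPochInf_le hQ m
    have h14 := inv_le_four h1
    have h5 : (qPoch Q m)⁻¹ - (qPochInf Q)⁻¹ =
        -((qPoch Q m - qPochInf Q) * ((qPoch Q m)⁻¹ * (qPochInf Q)⁻¹)) := by
      have : qPoch Q m ≠ 0 := by linarith
      have : qPochInf Q ≠ 0 := by linarith
      field_simp
      ring
    have h6 : (2 : ℝ) ^ (-((m : ℤ) : ℝ)) = (1 / 2) ^ m := by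
      rw [Int.cast_natCast, Real.rpow_neg (by norm_num), Real.rpow_natCast]; simp
    have h7 : (qPoch Q m)⁻¹ * (qPochInf Q)⁻¹ ≤ 16 := by
      have : 0 < (qPoch Q m)⁻¹ := by positivity
      nlinarith
    have h8 : 0 ≤ (qPoch Q m)⁻¹ * (qPochInf Q)⁻¹ := by positivity
    rw [Int.toNat_natCast, h5, h6, abs_neg, abs_of_nonneg (mul_nonneg (by linarith) h8)]
    nlinarith
  · have h1 : (1 : ℝ) ≤ 2 ^ (-(m : ℝ)) := by
      apply Real.one_le_rpow (by norm_num)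
      have : (m : ℝ) ≤ 0 := by exact_mod_cast (not_le.1 h).le
      linarith
    rw [zero_sub, abs_neg, abs_of_pos hi0]
    linarith

lemma abs_prod_sub_prod_le {ι : Type*} (S : Finset ι) (x y : ι → ℝ)
    {B : ℝ} (hB : 1 ≤ B) (hx : ∀ i, |x i| ≤ B) (hy : ∀ i, |y i| ≤ B) :
    |∏ i ∈ S, x i - ∏ i ∈ S, y i| ≤ B ^ #S * ∑ i ∈ S, |x i - y i| := by
  classical
  induction S using Finset.induction_on with
  | empty => simp
  | insert i S hi ih =>
    rw [prod_insert hi, prod_insert hi, sum_insert hi, card_insert_of_notMem hi]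
    have h1 : x i * ∏ j ∈ S, x j - y i * ∏ j ∈ S, y j =
      (x i - y i) * ∏ j ∈ S, x j + y i * (∏ j ∈ S, x j - ∏ j ∈ S, y j) := by ring
    have h2 : |∏ j ∈ S, x j| ≤ B ^ #S := by
      rw [abs_prod]
      exact (prod_le_prod (fun _ _ ↦ abs_nonneg _) fun j _ ↦ hx j).trans_eq (prod_const B)
    have h3 : B ^ #S ≤ B ^ (#S + 1) := pow_le_pow_right₀ hB (by omega)
    rw [h1]
    calc _ ≤ |x i - y i| * |∏ j ∈ S, x j| + |y i| * |∏ j ∈ S, x j - ∏ j ∈ S, y j| := by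
          rw [← abs_mul, ← abs_mul]; exact abs_add_le _ _
      _ ≤ |x i - y i| * B ^ (#S + 1) + B * (B ^ #S * ∑ i ∈ S, |x i - y i|) := by
          gcongr
          · exact h2.trans h3
          · exact hy i
      _ = _ := by ring

end QPochhammer

section Weights

open Finset

lemma sum_prod_apply_le_tsum_pow {ι κ : Type*} [Fintype ι] {h : κ → ℝ}
    (h0 : ∀ k, 0 ≤ h k) (hs : Summable h) (u : Finset (ι → κ)) :
    ∑ m ∈ u, ∏ i, h (m i) ≤ (∑' k, h k) ^ Fintype.card ι := by
  classical
  calc ∑ m ∈ u, ∏ i, h (m i)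
      ≤ ∑ m ∈ Fintype.piFinset fun i ↦ u.image (· i), ∏ i, h (m i) :=
        sum_le_sum_of_subset_of_nonneg
          (fun m hm ↦ Fintype.mem_piFinset.2 fun i ↦ mem_image_of_mem (· i) hm)
          fun _ _ _ ↦ prod_nonneg fun _ _ ↦ h0 _
    _ = ∏ i, ∑ k ∈ u.image (· i), h k := (prod_univ_sum _ _).symm
    _ ≤ ∏ _i : ι, ∑' k, h k :=
        prod_le_prod (fun _ _ ↦ sum_nonneg fun _ _ ↦ h0 _)
          fun _ _ ↦ hs.sum_le_tsum _ fun _ _ ↦ h0 _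
    _ = _ := by simp

lemma summable_prod_apply {ι κ : Type*} [Fintype ι] {h : κ → ℝ}
    (h0 : ∀ k, 0 ≤ h k) (hs : Summable h) : Summable fun m : ι → κ ↦ ∏ i, h (m i) :=
  summable_of_sum_le (fun _ ↦ prod_nonneg fun _ _ ↦ h0 _) (sum_prod_apply_le_tsum_pow h0 hs)

lemma tsum_prod_apply_le {ι κ : Type*} [Fintype ι] {h : κ → ℝ}
    (h0 : ∀ k, 0 ≤ h k) (hs : Summable h) :
    ∑' m : ι → κ, ∏ i, h (m i) ≤ (∑' k, h k) ^ Fintype.card ι :=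
  (summable_prod_apply h0 hs).tsum_le_of_sum_le (sum_prod_apply_le_tsum_pow h0 hs)

/-- A summable majorant on `ℤ` of shifted Gaussians times exponentials. -/
noncomputable def expMajorant (k : ℤ) : ℝ := 4 * (1 / 2 : ℝ) ^ k.natAbs

lemma expMajorant_nonneg (k : ℤ) : 0 ≤ expMajorant k := by unfold expMajorant; positivity

lemma summable_expMajorant : Summable expMajorant := by
  have : Summable fun n : ℕ ↦ (4 : ℝ) * (1 / 2) ^ n := summable_geometric_two.mul_left 4
  exact Summable.of_nat_of_neg (by simpa [expMajorant] using this)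
    (by simpa [expMajorant] using this)

lemma summable_expMajorant_sub (f : ℤ) : Summable fun k : ℤ ↦ expMajorant (k - f) :=
  summable_expMajorant.comp_injective (sub_left_injective (b := f))

lemma tsum_expMajorant_sub (f : ℤ) : ∑' k : ℤ, expMajorant (k - f) = ∑' k, expMajorant k :=
  (Equiv.subRight f).tsum_eq expMajorant

lemma rpow_abs_sub_sq_le (c : ℝ) (k : ℤ) :
    (2 : ℝ) ^ (|(k : ℝ) - c| - ((k : ℝ) - c) ^ 2) ≤ expMajorant (k - ⌊c⌋) := by
  have h1 : ((k - ⌊c⌋).natAbs : ℝ) ≤ |(k : ℝ) - c| + 1 := by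
    rw [Nat.cast_natAbs]
    push_cast
    have : (k : ℝ) - ⌊c⌋ = (k - c) + Int.fract c := by rw [Int.fract]; ring
    rw [this]
    refine (abs_add_le _ _).trans ?_
    rw [abs_of_nonneg (Int.fract_nonneg c)]
    linarith [Int.fract_lt_one c]
  have h2 : expMajorant (k - ⌊c⌋) = 2 ^ (2 - ((k - ⌊c⌋).natAbs : ℝ)) := by
    rw [expMajorant, Real.rpow_sub (by norm_num), Real.rpow_natCast]
    rw [one_div, inv_pow, ← div_eq_mul_inv]
    norm_num
  rw [h2]
  apply Real.rpow_le_rpow_of_exponent_le (by norm_num)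
  have := sq_abs ((k : ℝ) - c)
  nlinarith [sq_nonneg (|(k : ℝ) - c| - 1)]

lemma gaussian_mul_le {ι : Type*} [Fintype ι] (c : ℝ) (m : ι → ℤ) :
    (2 : ℝ) ^ (-∑ i, ((m i : ℝ) - c) ^ 2) * (1 + ∑ i, (2 : ℝ) ^ (-((m i : ℝ) - c))) ≤
      (1 + Fintype.card ι) * ∏ i, expMajorant (m i - ⌊c⌋) := by
  have h1 : (1 + ∑ i, (2 : ℝ) ^ (-((m i : ℝ) - c))) ≤
      (1 + Fintype.card ι) * 2 ^ (∑ i, |(m i : ℝ) - c|) := by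
    rw [add_mul, one_mul]
    apply add_le_add
    · exact Real.one_le_rpow (by norm_num) (sum_nonneg fun _ _ ↦ abs_nonneg _)
    · calc _ ≤ ∑ _i : ι, (2 : ℝ) ^ (∑ i, |(m i : ℝ) - c|) := by
            refine sum_le_sum fun i _ ↦ Real.rpow_le_rpow_of_exponent_le (by norm_num) ?_
            exact (neg_le_abs _).trans
              (single_le_sum (f := fun i ↦ |(m i : ℝ) - c|) (fun _ _ ↦ abs_nonneg _) (mem_univ i))
        _ = _ := by simp
  calc _ ≤ (2 : ℝ) ^ (-∑ i, ((m i : ℝ) - c) ^ 2) *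
        ((1 + Fintype.card ι) * 2 ^ (∑ i, |(m i : ℝ) - c|)) := by gcongr
    _ = (1 + Fintype.card ι) * ∏ i, (2 : ℝ) ^ (|(m i : ℝ) - c| - ((m i : ℝ) - c) ^ 2) := by
        rw [← Real.rpow_sum_of_pos (by norm_num), sum_sub_distrib, sub_eq_neg_add,
          Real.rpow_add (by norm_num)]
        ring
    _ ≤ _ := by
        gcongr with i
        exact rpow_abs_sub_sq_le c (m i)

lemma rpow_neg_sum_sq_le {ι : Type*} [Fintype ι] {q : ℝ} (hq : 2 ≤ q) (c : ℝ) (m : ι → ℤ) :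
    q ^ (-∑ i, ((m i : ℝ) - c) ^ 2) ≤ (2 : ℝ) ^ (-∑ i, ((m i : ℝ) - c) ^ 2) := by
  apply Real.rpow_le_rpow_of_nonpos (by norm_num) hq
  have : 0 ≤ ∑ i, ((m i : ℝ) - c) ^ 2 := sum_nonneg fun _ _ ↦ sq_nonneg _
  linarith

/-- The normalised finite-level weight. -/
noncomputable def weight {ι : Type*} (q : ℝ) (S : Finset ι) (l : ι → ℕ) (n : ℕ) (m : ι → ℤ) : ℝ :=
  qPoch q n * ∏ s ∈ S, qPochInv (q ^ l s) (m s)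

/-- The limit of `weight`. -/
noncomputable def weightInf {ι : Type*} (q : ℝ) (S : Finset ι) (l : ι → ℕ) : ℝ :=
  qPochInf q / ∏ s ∈ S, qPochInf (q ^ l s)

lemma abs_weight_sub_le {ι : Type*} [Fintype ι] {q : ℝ} (hq : 2 ≤ q) (S : Finset ι)
    {l : ι → ℕ} (hl : ∀ i, 1 ≤ l i) (n : ℕ) (m : ι → ℤ) :
    |weight q S l n m - weightInf q S l| ≤
      16 * 4 ^ Fintype.card ι * ((1 / 2) ^ n + ∑ i, (2 : ℝ) ^ (-(m i : ℝ))) := by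
  have hQ : ∀ i, 2 ≤ q ^ l i := fun i ↦
    hq.trans (le_self_pow₀ (by linarith) (by have := hl i; omega))
  have hS : (4 : ℝ) ^ #S ≤ 4 ^ Fintype.card ι :=
    pow_le_pow_right₀ (by norm_num) (card_le_univ S)
  have hx : ∀ i, |qPochInv (q ^ l i) (m i)| ≤ 4 := fun i ↦ by
    rw [abs_of_nonneg (qPochInv_nonneg (hQ i) _)]; exact qPochInv_le (hQ i) _
  have hy : ∀ i, |(qPochInf (q ^ l i))⁻¹| ≤ 4 := fun i ↦ by
    have := quarter_le_qPochInf (hQ i)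
    rw [abs_of_nonneg (by positivity)]; exact inv_le_four this
  have h1 := abs_prod_sub_prod_le S _ _ (by norm_num) hx hy
  have h2 : ∑ i ∈ S, |qPochInv (q ^ l i) (m i) - (qPochInf (q ^ l i))⁻¹| ≤
      16 * ∑ i, (2 : ℝ) ^ (-(m i : ℝ)) := by
    calc _ ≤ ∑ i ∈ S, 16 * (2 : ℝ) ^ (-(m i : ℝ)) :=
          sum_le_sum fun i _ ↦ abs_qPochInv_sub_le (hQ i) (m i)
      _ ≤ ∑ i, 16 * (2 : ℝ) ^ (-(m i : ℝ)) :=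
          sum_le_sum_of_subset_of_nonneg (subset_univ _) fun _ _ _ ↦ by positivity
      _ = _ := (mul_sum _ _ _).symm
  have h3 : |∏ i ∈ S, qPochInv (q ^ l i) (m i)| ≤ 4 ^ #S := by
    rw [abs_prod]
    exact (prod_le_prod (fun _ _ ↦ abs_nonneg _) fun j _ ↦ hx j).trans_eq (prod_const 4)
  have h4 : |qPoch q n - qPochInf q| ≤ (1 / 2) ^ n := by
    rw [abs_of_nonneg (sub_nonneg.2 (qPochInf_le_qPoch hq n))]
    exact qPoch_sub_qPochInf_le hq n
  have h5 : |qPochInf q| ≤ 1 := by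
    rw [abs_of_nonneg (by linarith [quarter_le_qPochInf hq])]
    exact (qPochInf_le_qPoch hq 0).trans (qPoch_le_one hq 0)
  have h6 : weight q S l n m - weightInf q S l =
      (qPoch q n - qPochInf q) * ∏ i ∈ S, qPochInv (q ^ l i) (m i) +
      qPochInf q * (∏ i ∈ S, qPochInv (q ^ l i) (m i) - ∏ i ∈ S, (qPochInf (q ^ l i))⁻¹) := by
    rw [weight, weightInf, prod_inv_distrib]
    ring
  rw [h6]
  have hs : 0 ≤ ∑ i, (2 : ℝ) ^ (-(m i : ℝ)) := sum_nonneg fun _ _ ↦ by positivity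
  calc _ ≤ |qPoch q n - qPochInf q| * |∏ i ∈ S, qPochInv (q ^ l i) (m i)| + |qPochInf q| *
        |∏ i ∈ S, qPochInv (q ^ l i) (m i) - ∏ i ∈ S, (qPochInf (q ^ l i))⁻¹| := by
        rw [← abs_mul, ← abs_mul]; exact abs_add_le _ _
    _ ≤ (1 / 2) ^ n * 4 ^ Fintype.card ι +
        1 * (4 ^ Fintype.card ι * (16 * ∑ i, (2 : ℝ) ^ (-(m i : ℝ)))) := by
        gcongr
        · exact h3.trans hS
        · exact h1.trans (mul_le_mul hS h2 (sum_nonneg fun _ _ ↦ abs_nonneg _) (by positivity))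
    _ ≤ _ := by
        have : 0 ≤ (1 / 2 : ℝ) ^ n * 4 ^ Fintype.card ι := by positivity
        linarith

lemma summable_gaussian {ι : Type*} [Fintype ι] {q : ℝ} (hq : 2 ≤ q) (c : ℝ) :
    Summable fun m : ι → ℤ ↦ q ^ (-∑ i, ((m i : ℝ) - c) ^ 2) := by
  have hs := summable_expMajorant_sub ⌊c⌋
  refine Summable.of_nonneg_of_le (fun m ↦ by positivity) (fun m ↦ ?_)
    ((summable_prod_apply (ι := ι) (fun k ↦ expMajorant_nonneg _) hs).mul_left
      (1 + (Fintype.card ι : ℝ)))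
  refine (rpow_neg_sum_sq_le hq c m).trans ((le_mul_of_one_le_right (by positivity) ?_).trans
    (gaussian_mul_le c m))
  have hs : 0 ≤ ∑ i, (2 : ℝ) ^ (-((m i : ℝ) - c)) := sum_nonneg fun _ _ ↦ by positivity
  linarith

lemma abs_weight_sub_mul_gaussian_le {ι : Type*} [Fintype ι] [Nonempty ι] {q : ℝ} (hq : 2 ≤ q)
    (S : Finset ι) {l : ι → ℕ} (hl : ∀ i, 1 ≤ l i) (n : ℕ) (m : ι → ℤ) :
    |weight q S l n m - weightInf q S l| *
        q ^ (-∑ i, ((m i : ℝ) - n / Fintype.card ι) ^ 2) ≤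
      16 * 4 ^ Fintype.card ι * 2 ^ (-(n / Fintype.card ι : ℝ)) * (1 + Fintype.card ι) *
        ∏ i, expMajorant (m i - ⌊(n / Fintype.card ι : ℝ)⌋) := by
  set c : ℝ := n / Fintype.card ι with hc
  have h1 : (1 / 2 : ℝ) ^ n + ∑ i, (2 : ℝ) ^ (-(m i : ℝ)) ≤
      2 ^ (-c) * (1 + ∑ i, (2 : ℝ) ^ (-((m i : ℝ) - c))) := by
    rw [mul_add, mul_one, mul_sum]
    apply add_le_add
    · have : (1 / 2 : ℝ) ^ n = 2 ^ (-(n : ℝ)) := by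
        rw [Real.rpow_neg (by norm_num), Real.rpow_natCast]; simp
      rw [this]
      apply Real.rpow_le_rpow_of_exponent_le (by norm_num)
      have : c ≤ n := div_le_self (by positivity) (by exact_mod_cast Fintype.card_pos)
      linarith
    · refine le_of_eq (sum_congr rfl fun i _ ↦ ?_)
      rw [← Real.rpow_add (by norm_num)]
      congr 1; ring
  calc _ ≤ 16 * 4 ^ Fintype.card ι * (2 ^ (-c) * (1 + ∑ i, (2 : ℝ) ^ (-((m i : ℝ) - c)))) *
        2 ^ (-∑ i, ((m i : ℝ) - c) ^ 2) := by
        refine mul_le_mul ((abs_weight_sub_le hq S hl n m).trans ?_) (rpow_neg_sum_sq_le hq c m)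
          (by positivity) (by positivity)
        gcongr
    _ = 16 * 4 ^ Fintype.card ι * 2 ^ (-c) * (2 ^ (-∑ i, ((m i : ℝ) - c) ^ 2) *
        (1 + ∑ i, (2 : ℝ) ^ (-((m i : ℝ) - c)))) := by ring
    _ ≤ 16 * 4 ^ Fintype.card ι * 2 ^ (-c) *
        ((1 + Fintype.card ι) * ∏ i, expMajorant (m i - ⌊c⌋)) :=
        mul_le_mul_of_nonneg_left (gaussian_mul_le c m) (by positivity)
    _ = _ := by ring

theorem exists_forall_abs_tsum_weight_sub_lt (ι : Type*) [Fintype ι] [Nonempty ι] {ε : ℝ}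
    (hε : 0 < ε) :
    ∃ N : ℕ, ∀ q : ℝ, 2 ≤ q → ∀ n : ℕ, N < n → ∀ (S : Finset ι) (l : ι → ℕ), (∀ i, 1 ≤ l i) →
      ∀ P : (ι → ℤ) → Prop,
      |∑' m : {m // P m}, weight q S l n m.1 *
            q ^ (-∑ i, ((m.1 i : ℝ) - n / Fintype.card ι) ^ 2) -
          weightInf q S l * ∑' m : {m // P m},
            q ^ (-∑ i, ((m.1 i : ℝ) - n / Fintype.card ι) ^ 2)| < ε := by
  set d := Fintype.card ι with hd
  have hd0 : (0 : ℝ) < d := by exact_mod_cast Fintype.card_pos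
  set K : ℝ := 16 * 4 ^ d * (1 + d) * (∑' k, expMajorant k) ^ d with hK
  have hlim : Filter.Tendsto (fun n : ℕ ↦ K * (2 : ℝ) ^ (-(n / d : ℝ))) Filter.atTop (nhds 0) := by
    have h1 : Filter.Tendsto (fun n : ℕ ↦ ((2 : ℝ) ^ (-(1 / d : ℝ))) ^ n) Filter.atTop (nhds 0) :=
      tendsto_pow_atTop_nhds_zero_of_lt_one (by positivity)
        (Real.rpow_lt_one_of_one_lt_of_neg (by norm_num) (by simpa using hd0))
    simpa [← Real.rpow_mul_natCast, div_eq_inv_mul] using h1.const_mul K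
  obtain ⟨N, hN⟩ := Filter.eventually_atTop.1 (hlim.eventually_lt_const hε)
  refine ⟨N, fun q hq n hn S l hl P ↦ lt_of_le_of_lt ?_ (hN n hn.le)⟩
  set c : ℝ := n / d with hc
  have hs := summable_expMajorant_sub ⌊c⌋
  have hp := summable_prod_apply (ι := ι) (fun k ↦ expMajorant_nonneg (k - ⌊c⌋)) hs
  have ht := tsum_prod_apply_le (ι := ι) (fun k ↦ expMajorant_nonneg (k - ⌊c⌋)) hs
  rw [tsum_expMajorant_sub] at ht
  set A : ℝ := 16 * 4 ^ d * 2 ^ (-c) * (1 + d) with hA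
  have hb : ∀ m : {m // P m}, ‖weight q S l n m.1 * q ^ (-∑ i, ((m.1 i : ℝ) - c) ^ 2) -
      weightInf q S l * q ^ (-∑ i, ((m.1 i : ℝ) - c) ^ 2)‖ ≤
      A * ∏ i, expMajorant (m.1 i - ⌊c⌋) := fun m ↦ by
    have hq0 : 0 ≤ q ^ (-∑ i, ((m.1 i : ℝ) - c) ^ 2) := by positivity
    rw [← sub_mul, norm_mul, Real.norm_of_nonneg hq0]
    exact abs_weight_sub_mul_gaussian_le hq S hl n m.1
  have hsub : Summable fun m : {m // P m} ↦ A * ∏ i, expMajorant (m.1 i - ⌊c⌋) :=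
    (hp.mul_left A).subtype P
  have hsd := Summable.of_norm_bounded hsub hb
  have hg : Summable fun m : {m // P m} ↦
      weightInf q S l * q ^ (-∑ i, ((m.1 i : ℝ) - c) ^ 2) :=
    ((summable_gaussian hq c).subtype P).mul_left _
  have hw : Summable fun m : {m // P m} ↦
      weight q S l n m.1 * q ^ (-∑ i, ((m.1 i : ℝ) - c) ^ 2) := by
    simpa using hsd.add hg
  rw [← tsum_mul_left, ← hw.tsum_sub hg]
  calc _ ≤ ∑' m : {m // P m}, A * ∏ i, expMajorant (m.1 i - ⌊c⌋) :=
        tsum_of_norm_bounded hsub.hasSum hb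
    _ ≤ ∑' m : ι → ℤ, A * ∏ i, expMajorant (m i - ⌊c⌋) :=
        (hp.mul_left A).tsum_subtype_le _ P fun m ↦
          mul_nonneg (by positivity) (prod_nonneg fun _ _ ↦ expMajorant_nonneg _)
    _ ≤ A * (∑' k, expMajorant k) ^ d := by
        rw [tsum_mul_left]
        gcongr
    _ = _ := by rw [hA, hK]; ring

end Weights

section TorsionModules

open Polynomial

section PiCoprime

variable {R ι : Type*} [CommRing R] [DecidableEq ι] {M N : ι → Type*}
  [∀ i, AddCommGroup (M i)] [∀ i, Module R (M i)] [∀ i, AddCommGroup (N i)] [∀ i, Module R (N i)]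

lemma map_single_apply_eq_zero_of_isCoprime {p : ι → R} (hp : Pairwise fun i j ↦ IsCoprime (p i) (p j))
    (hM : ∀ i (x : M i), p i • x = 0) (hN : ∀ i (x : N i), p i • x = 0)
    (e : (∀ i, M i) →ₗ[R] ∀ i, N i) {i j : ι} (hij : i ≠ j) (x : M i) :
    e (Pi.single i x) j = 0 := by
  obtain ⟨a, b, hab⟩ := hp hij
  have h1 : p i • e (Pi.single i x) j = 0 := by
    rw [← Pi.smul_apply, ← map_smul, ← Pi.single_smul, hM, Pi.single_zero, map_zero, Pi.zero_apply]
  rw [← one_smul R (e (Pi.single i x) j), ← hab, add_smul, mul_smul, mul_smul, h1, hN,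
    smul_zero, smul_zero, add_zero]

lemma map_single_eq_single_of_isCoprime {p : ι → R} (hp : Pairwise fun i j ↦ IsCoprime (p i) (p j))
    (hM : ∀ i (x : M i), p i • x = 0) (hN : ∀ i (x : N i), p i • x = 0)
    (e : (∀ i, M i) →ₗ[R] ∀ i, N i) (i : ι) (x : M i) :
    e (Pi.single i x) = Pi.single i (e (Pi.single i x) i) := by
  ext j
  rcases eq_or_ne j i with rfl | h
  · simp
  · rw [map_single_apply_eq_zero_of_isCoprime hp hM hN e h.symm, Pi.single_eq_of_ne h]

/-- Isomorphisms between products of modules killed by pairwise coprime elements are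
componentwise. -/
def piLinearEquivOfIsCoprime [Fintype ι] {p : ι → R} (hp : Pairwise fun i j ↦ IsCoprime (p i) (p j))
    (hM : ∀ i (x : M i), p i • x = 0) (hN : ∀ i (x : N i), p i • x = 0) :
    ((∀ i, M i) ≃ₗ[R] ∀ i, N i) ≃ ∀ i, M i ≃ₗ[R] N i where
  toFun e i := LinearEquiv.ofLinearMap
    (LinearMap.proj i ∘ₗ e.toLinearMap ∘ₗ LinearMap.single R M i)
    (LinearMap.proj i ∘ₗ e.symm.toLinearMap ∘ₗ LinearMap.single R N i)
    (by
      ext x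
      have := map_single_eq_single_of_isCoprime hp hN hM e.symm.toLinearMap i x
      simp only [LinearEquiv.coe_coe] at this
      simp [← this])
    (by
      ext x
      have := map_single_eq_single_of_isCoprime hp hM hN e.toLinearMap i x
      simp only [LinearEquiv.coe_coe] at this
      simp [← this])
  invFun e := LinearEquiv.piCongrRight e
  left_inv e := by
    refine LinearEquiv.toLinearMap_injective (LinearMap.pi_ext fun i x ↦ ?_)
    have := map_single_eq_single_of_isCoprime hp hM hN e.toLinearMap i x
    simp only [LinearEquiv.coe_coe] at this
    ext j
    rcases eq_or_ne j i with rfl | h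
    · simp
    · simp only [LinearEquiv.coe_coe]
      rw [this]
      simp [Pi.single_eq_of_ne h]
  right_inv e := by
    ext i x
    simp

end PiCoprime

lemma exists_linearEquiv_pi_of_isTorsionBy {R ι M : Type*} [CommRing R] [Fintype ι]
    [AddCommGroup M] [Module R M] [Module.Finite R M] {p : ι → R}
    (hp : Pairwise fun i j ↦ IsCoprime (p i) (p j)) (hmax : ∀ i, (Ideal.span {p i}).IsMaximal)
    (hM : Module.IsTorsionBy R M (∏ i, p i)) [IsNoetherianRing R] :
    ∃ m : ι → ℕ, Nonempty (M ≃ₗ[R] ∀ i, Fin (m i) → R ⧸ Ideal.span {p i}) := by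
  classical
  have h1 : ∀ i, ∃ k : ℕ, Nonempty (Submodule.torsionBy R M (p i) ≃ₗ[R] (Fin k → R ⧸ Ideal.span {p i})) := by
    intro i
    have := hmax i
    let _ : Field (R ⧸ Ideal.span {p i}) := Ideal.Quotient.field _
    have : Module.Finite (R ⧸ Ideal.span {p i}) (Submodule.torsionBy R M (p i)) :=
      Module.Finite.of_restrictScalars_finite R _ _
    exact ⟨_, ⟨(Module.finBasis (R ⧸ Ideal.span {p i})
      (Submodule.torsionBy R M (p i))).equivFun.restrictScalars R⟩⟩
  choose m e using h1
  refine ⟨m, ?_⟩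
  have hint := Submodule.torsionBy_isInternal (S := Finset.univ) (q := p)
    (fun i _ j _ hij ↦ hp hij) hM
  let e1 := (LinearEquiv.ofBijective (DirectSum.coeLinearMap
    fun i : (Finset.univ : Finset ι) ↦ Submodule.torsionBy R M (p i)) hint).symm
  let e2 := DirectSum.linearEquivFunOnFintype R (Finset.univ : Finset ι)
    (fun i ↦ Submodule.torsionBy R M (p i))
  let e3 : (∀ i : (Finset.univ : Finset ι), Submodule.torsionBy R M (p i)) ≃ₗ[R]
      ∀ i, Submodule.torsionBy R M (p i) :=
    LinearEquiv.piCongrLeft R (fun i ↦ Submodule.torsionBy R M (p i))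
      (Equiv.subtypeUnivEquiv Finset.mem_univ)
  exact ⟨((e1.trans e2).trans e3).trans (LinearEquiv.piCongrRight fun i ↦ (e i).some)⟩

section ModelCount

variable {F V W : Type*} [Field F] [AddCommGroup V] [Module F V] [AddCommGroup W] [Module F W]
  [Module F[X] W] [IsScalarTower F F[X] W]

/-- The endomorphism of `V` obtained from multiplication by `X` on `W`. -/
noncomputable def endOfLinearEquiv (e : V ≃ₗ[F] W) : Module.End F V :=
  e.symm.toLinearMap ∘ₗ Algebra.lsmul F F W (X : F[X]) ∘ₗ e.toLinearMap

lemma endOfLinearEquiv_eq_iff (e : V ≃ₗ[F] W) (t : Module.End F V) :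
    endOfLinearEquiv e = t ↔ ∀ v, e (t v) = (X : F[X]) • e v := by
  simp only [LinearMap.ext_iff, endOfLinearEquiv, LinearMap.comp_apply, LinearEquiv.coe_coe,
    LinearEquiv.symm_apply_eq, Algebra.lsmul_coe]
  exact forall_congr' fun _ ↦ eq_comm

/-- Linear equivalences inducing `t` correspond to `F[X]`-linear equivalences. -/
noncomputable def endOfLinearEquivFiber (t : Module.End F V) :
    {e : V ≃ₗ[F] W // endOfLinearEquiv e = t} ≃ (Module.AEval' t ≃ₗ[F[X]] W) where
  toFun e := LinearEquiv.ofAEval t e.1 ((endOfLinearEquiv_eq_iff e.1 t).1 e.2)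
  invFun e := ⟨(Module.AEval'.of t).trans (e.restrictScalars F),
    (endOfLinearEquiv_eq_iff _ t).2 fun v ↦ by
      simp [← Module.AEval'.X_smul_of]⟩
  left_inv e := by
    ext v
    rfl
  right_inv e := by
    ext v
    rfl

lemma nonempty_linearEquiv_endOfLinearEquiv (e : V ≃ₗ[F] W) :
    Nonempty (Module.AEval' (endOfLinearEquiv e) ≃ₗ[F[X]] W) :=
  ⟨endOfLinearEquivFiber _ ⟨e, rfl⟩⟩

/-- Orbit–stabiliser for `F[X]`-module structures on `V` isomorphic to `W`. -/
theorem card_mul_card_aut_eq (e₀ : V ≃ₗ[F] W) :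
    Nat.card {t : Module.End F V // Nonempty (Module.AEval' t ≃ₗ[F[X]] W)} *
      Nat.card (W ≃ₗ[F[X]] W) = Nat.card (V ≃ₗ[F] V) := by
  let f : (V ≃ₗ[F] W) → {t : Module.End F V // Nonempty (Module.AEval' t ≃ₗ[F[X]] W)} :=
    fun e ↦ ⟨endOfLinearEquiv e, nonempty_linearEquiv_endOfLinearEquiv e⟩
  have h1 : ∀ t, {e // f e = t} ≃ (W ≃ₗ[F[X]] W) := fun t ↦
    ((Equiv.subtypeEquivRight fun e ↦ Subtype.ext_iff).trans (endOfLinearEquivFiber t.1)).trans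
      { toFun := fun e ↦ t.2.some.symm.trans e
        invFun := fun e ↦ t.2.some.trans e
        left_inv := fun e ↦ by ext; simp
        right_inv := fun e ↦ by ext; simp }
  rw [← Nat.card_prod, ← Nat.card_congr (Equiv.sigmaEquivProd _ _),
    ← Nat.card_congr (Equiv.sigmaCongrRight h1), Nat.card_congr (Equiv.sigmaFiberEquiv f)]
  exact Nat.card_congr
    { toFun := fun e ↦ e.trans e₀.symm
      invFun := fun e ↦ e.trans e₀
      left_inv := fun e ↦ by ext; simp
      right_inv := fun e ↦ by ext; simp }

end ModelCount

end TorsionModules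

section Models

open Polynomial

lemma Matrix.det_blockDiagonal'_eq {ι R : Type*} {n : ι → Type*} [Fintype ι] [DecidableEq ι]
    [∀ i, Fintype (n i)] [∀ i, DecidableEq (n i)] [CommRing R] (A : ∀ i, Matrix (n i) (n i) R) :
    (Matrix.blockDiagonal' A).det = ∏ i, (A i).det := by
  let _ : LinearOrder ι := LinearOrder.lift' (Fintype.equivFin ι) (Fintype.equivFin ι).injective
  rw [(Matrix.blockTriangular_blockDiagonal' A).det_fintype]
  refine Finset.prod_congr rfl fun k _ ↦ ?_
  rw [← Matrix.det_reindex_self (Equiv.sigmaSubtype k)]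
  congr 1
  ext i j
  simp only [Matrix.toSquareBlock_def, Matrix.reindex_apply, Matrix.submatrix_apply]
  exact Matrix.blockDiagonal'_apply_eq A k i j

lemma LinearMap.det_pi_eq_prod {ι R : Type*} {M : ι → Type*} [Fintype ι] [CommRing R]
    [∀ i, AddCommGroup (M i)] [∀ i, Module R (M i)] [∀ i, Module.Free R (M i)]
    [∀ i, Module.Finite R (M i)] (f : ∀ i, M i →ₗ[R] M i) :
    (LinearMap.pi fun i ↦ f i ∘ₗ LinearMap.proj i).det = ∏ i, (f i).det := by
  classical
  let b i := Module.Free.chooseBasis R (M i)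
  simp_rw [← LinearMap.det_toMatrix (Pi.basis b), ← LinearMap.det_toMatrix (b _)]
  rw [← Matrix.det_blockDiagonal'_eq]
  congr 1
  ext ⟨i, x⟩ ⟨j, y⟩
  rcases eq_or_ne i j with rfl | h
  · rw [Matrix.blockDiagonal'_apply_eq]
    simp [LinearMap.toMatrix_apply]
  · rw [Matrix.blockDiagonal'_apply_ne _ _ _ h]
    simp [LinearMap.toMatrix_apply, Pi.single_eq_of_ne h]

section Model

variable {F ι : Type*} [Field F] [Fintype ι]

/-- The `F[X]`-module `∏ i, (F[X] / f i) ^ m i`. -/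
abbrev PolyModel (f : ι → F[X]) (m : ι → ℕ) : Type _ := ∀ i, Fin (m i) → F[X] ⧸ Ideal.span {f i}

lemma smul_fin_quotient_span_eq_zero (p : F[X]) (n : ℕ) (x : Fin n → F[X] ⧸ Ideal.span {p}) :
    p • x = 0 := by
  ext j
  obtain ⟨y, hy⟩ := Ideal.Quotient.mk_surjective (x j)
  rw [Pi.smul_apply, ← hy, ← Ideal.Quotient.mk_eq_mk, ← Submodule.Quotient.mk_smul]
  exact (Submodule.Quotient.mk_eq_zero _).2
    (Ideal.mul_mem_right _ _ (Ideal.subset_span rfl))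

lemma finrank_polyModel {f : ι → F[X]} (hf : ∀ i, f i ≠ 0) (m : ι → ℕ) :
    Module.finrank F (PolyModel f m) = ∑ i, m i * (f i).natDegree := by
  have (i : ι) : Module.Finite F (F[X] ⧸ Ideal.span {f i}) :=
    (AdjoinRoot.powerBasis (hf i)).finite
  rw [Module.finrank_pi_fintype]
  refine Finset.sum_congr rfl fun i _ ↦ ?_
  rw [Module.finrank_pi_fintype, finrank_quotient_span_eq_natDegree]
  simp

lemma finite_polyModel {f : ι → F[X]} (hf : ∀ i, f i ≠ 0) (m : ι → ℕ) :
    Module.Finite F (PolyModel f m) := by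
  have (i : ι) : Module.Finite F (F[X] ⧸ Ideal.span {f i}) :=
    (AdjoinRoot.powerBasis (hf i)).finite
  infer_instance

lemma card_quotient_span [Fintype F] {p : F[X]} (hp : p ≠ 0) :
    Nat.card (F[X] ⧸ Ideal.span {p}) = Fintype.card F ^ p.natDegree := by
  have : Module.Finite F (F[X] ⧸ Ideal.span {p}) := (AdjoinRoot.powerBasis hp).finite
  rw [Module.natCard_eq_pow_finrank (K := F), finrank_quotient_span_eq_natDegree,
    Nat.card_eq_fintype_card]

lemma isMaximal_span_of_irreducible {p : F[X]} (hp : Irreducible p) :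
    (Ideal.span {p}).IsMaximal :=
  PrincipalIdealRing.isMaximal_of_irreducible hp

lemma card_fin_quotient_linearEquiv [Fintype F] {p : F[X]} (hp : Irreducible p) (n : ℕ) :
    Nat.card ((Fin n → F[X] ⧸ Ideal.span {p}) ≃ₗ[F[X]] (Fin n → F[X] ⧸ Ideal.span {p})) =
      ∏ i : Fin n, ((Fintype.card F ^ p.natDegree) ^ n - (Fintype.card F ^ p.natDegree) ^ (i : ℕ)) := by
  have := isMaximal_span_of_irreducible hp
  let _ : Field (F[X] ⧸ Ideal.span {p}) := Ideal.Quotient.field _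
  have : Module.Finite F (F[X] ⧸ Ideal.span {p}) := (AdjoinRoot.powerBasis hp.ne_zero).finite
  have : Finite (F[X] ⧸ Ideal.span {p}) := Module.finite_of_finite F
  let _ : Fintype (F[X] ⧸ Ideal.span {p}) := Fintype.ofFinite _
  rw [← card_quotient_span hp.ne_zero, Nat.card_eq_fintype_card (α := F[X] ⧸ _),
    ← Matrix.card_GL_field]
  have hs : Function.Surjective (algebraMap F[X] (F[X] ⧸ Ideal.span {p})) :=
    Ideal.Quotient.mk_surjective
  let e1 : ((Fin n → F[X] ⧸ Ideal.span {p}) ≃ₗ[F[X]] (Fin n → F[X] ⧸ Ideal.span {p})) ≃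
      ((Fin n → F[X] ⧸ Ideal.span {p}) ≃ₗ[F[X] ⧸ Ideal.span {p}]
        (Fin n → F[X] ⧸ Ideal.span {p})) :=
    { toFun := fun e ↦ e.extendScalarsOfSurjective hs
      invFun := fun e ↦ e.restrictScalars F[X]
      left_inv := fun e ↦ by ext; rfl
      right_inv := fun e ↦ by ext; rfl }
  exact Nat.card_congr (e1.trans
    ((LinearMap.GeneralLinearGroup.generalLinearEquiv _ _).symm.trans
      Matrix.GeneralLinearGroup.toLin.symm).toEquiv)

lemma card_polyModel_linearEquiv [Fintype F] {f : ι → F[X]} (hf : ∀ i, Irreducible (f i))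
    (hc : Pairwise fun i j ↦ IsCoprime (f i) (f j)) (m : ι → ℕ) :
    Nat.card (PolyModel f m ≃ₗ[F[X]] PolyModel f m) =
      ∏ i, ∏ j : Fin (m i), ((Fintype.card F ^ (f i).natDegree) ^ m i -
        (Fintype.card F ^ (f i).natDegree) ^ (j : ℕ)) := by
  classical
  rw [Nat.card_congr (piLinearEquivOfIsCoprime hc
    (fun i ↦ smul_fin_quotient_span_eq_zero (f i) (m i))
    (fun i ↦ smul_fin_quotient_span_eq_zero (f i) (m i))), Nat.card_pi]
  exact Finset.prod_congr rfl fun i _ ↦ card_fin_quotient_linearEquiv (hf i) (m i)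

lemma polyModel_injective {f : ι → F[X]} (hf : ∀ i, Irreducible (f i))
    (hc : Pairwise fun i j ↦ IsCoprime (f i) (f j)) {m m' : ι → ℕ}
    (e : PolyModel f m ≃ₗ[F[X]] PolyModel f m') : m = m' := by
  classical
  funext i
  have e1 := (piLinearEquivOfIsCoprime hc
    (fun i ↦ smul_fin_quotient_span_eq_zero (f i) (m i))
    (fun i ↦ smul_fin_quotient_span_eq_zero (f i) (m' i)) e i).restrictScalars F
  have : Module.Finite F (F[X] ⧸ Ideal.span {f i}) := (AdjoinRoot.powerBasis (hf i).ne_zero).finite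
  have h := e1.finrank_eq
  simp only [Module.finrank_pi_fintype, finrank_quotient_span_eq_natDegree, Finset.sum_const,
    Finset.card_univ, Fintype.card_fin, smul_eq_mul] at h
  exact Nat.eq_of_mul_eq_mul_right (hf i).natDegree_pos h

lemma algebraMap_norm_quotient_span {E : Type*} [Field E] [Algebra F E] {p : F[X]}
    (hp : p.Monic) (hs : (p.map (algebraMap F E)).Splits) :
    algebraMap F E (Algebra.norm F (Ideal.Quotient.mk (Ideal.span {p}) X)) = (p.aroots E).prod := by
  have h := Algebra.PowerBasis.norm_gen_eq_prod_roots (F := E) (AdjoinRoot.powerBasis' hp)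
  rw [AdjoinRoot.powerBasis'_gen, AdjoinRoot.minpoly_root hp.ne_zero, hp.leadingCoeff, inv_one,
    C_1, mul_one] at h
  exact h hs

lemma algebraMap_det_polyModel {E : Type*} [Field E] [Algebra F E] {f : ι → F[X]}
    (hm : ∀ i, (f i).Monic) (hs : ∀ i, ((f i).map (algebraMap F E)).Splits) (m : ι → ℕ) :
    algebraMap F E (LinearMap.det (Algebra.lsmul F F (PolyModel f m) (X : F[X]))) =
      ∏ i, ((f i).aroots E).prod ^ m i := by
  have (i : ι) : Module.Finite F (F[X] ⧸ Ideal.span {f i}) :=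
    (AdjoinRoot.powerBasis (hm i).ne_zero).finite
  have h1 : Algebra.lsmul F F (PolyModel f m) (X : F[X]) =
      LinearMap.pi fun i ↦ (LinearMap.pi fun j ↦
        Algebra.lmul F _ (Ideal.Quotient.mk (Ideal.span {f i}) X) ∘ₗ LinearMap.proj j) ∘ₗ
          LinearMap.proj i := by
    ext v i j
    simp
    rfl
  rw [h1, LinearMap.det_pi_eq_prod, map_prod]
  refine Finset.prod_congr rfl fun i _ ↦ ?_
  rw [LinearMap.det_pi_eq_prod, Finset.prod_const, Finset.card_univ, Fintype.card_fin, map_pow,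
    ← Algebra.norm_apply, algebraMap_norm_quotient_span (hm i) (hs i)]

lemma det_endOfLinearEquiv {V W : Type*} [AddCommGroup V] [Module F V] [AddCommGroup W]
    [Module F W] [Module F[X] W] [IsScalarTower F F[X] W] (e : V ≃ₗ[F] W) :
    LinearMap.det (endOfLinearEquiv e) = LinearMap.det (Algebra.lsmul F F W (X : F[X])) := by
  rw [← LinearMap.det_conj _ e.symm]
  rfl

end Model

end Models

section CyclotomicFactors

open Polynomial

lemma FiniteField.mem_range_algebraMap_of_pow_card_eq {F E : Type*} [Field F] [Fintype F] [Field E]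
    [Algebra F E] {c : E} (hc : c ^ Fintype.card F = c) : c ∈ Set.range (algebraMap F E) := by
  have h1 : (X ^ Fintype.card F - X : F[X]).Splits := by
    rw [splits_iff_card_roots, FiniteField.roots_X_pow_card_sub_X,
      FiniteField.X_pow_card_sub_X_natDegree_eq _ Fintype.one_lt_card]
    rfl
  have h2 : c ∈ (X ^ Fintype.card F - X : F[X]).aroots E := by
    rw [mem_aroots]
    exact ⟨FiniteField.X_pow_card_sub_X_ne_zero _ Fintype.one_lt_card, by simp [hc]⟩
  rw [aroots, h1.roots_map, FiniteField.roots_X_pow_card_sub_X] at h2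
  simpa using h2

section Orbit

variable {a q : ℕ} [NeZero a]

/-- The orbit of `s` under multiplication by `q` on `ℤ/aℤ`. -/
noncomputable def frobOrbit (a q : ℕ) [NeZero a] (s : ZMod a) : Finset (ZMod a) := by
  classical exact Finset.univ.filter fun x ↦ ∃ e : ℕ, (q : ZMod a) ^ e * s = x

lemma mem_frobOrbit {s x : ZMod a} : x ∈ frobOrbit a q s ↔ ∃ e : ℕ, (q : ZMod a) ^ e * s = x := by
  simp [frobOrbit]

lemma self_mem_frobOrbit (s : ZMod a) : s ∈ frobOrbit a q s := mem_frobOrbit.2 ⟨0, by simp⟩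

lemma card_frobOrbit (s : ZMod a) : (frobOrbit a q s).card = orbitSize a q s := by
  rw [orbitSize, ← Nat.card_eq_finsetCard]
  simp_rw [mem_frobOrbit]

lemma image_mul_frobOrbit (hq : q.Coprime a) (s : ZMod a) :
    (frobOrbit a q s).image ((q : ZMod a) * ·) = frobOrbit a q s := by
  have hu : IsUnit (q : ZMod a) := (ZMod.isUnit_iff_coprime q a).2 hq
  refine Finset.eq_of_subset_of_card_le ?_ ?_
  · intro x hx
    obtain ⟨y, hy, rfl⟩ := Finset.mem_image.1 hx
    obtain ⟨e, rfl⟩ := mem_frobOrbit.1 hy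
    exact mem_frobOrbit.2 ⟨e + 1, by ring⟩
  · rw [Finset.card_image_of_injective _ hu.mul_right_injective]

@[to_additive]
lemma prod_prod_frobOrbit {S : Finset (ZMod a)} (hS : IsOrbitRepSet a q S) {M : Type*}
    [CommMonoid M] (f : ZMod a → M) : ∏ s ∈ S, ∏ i ∈ frobOrbit a q s, f i = ∏ i, f i := by
  classical
  rw [← Finset.prod_biUnion]
  · refine Finset.prod_congr ?_ fun _ _ ↦ rfl
    ext i
    obtain ⟨s, ⟨hs, he⟩, -⟩ := hS i
    simp only [Finset.mem_biUnion, Finset.mem_univ, iff_true]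
    exact ⟨s, hs, mem_frobOrbit.2 he⟩
  · intro s hs t ht hst
    rw [Function.onFun, Finset.disjoint_left]
    intro i hi hi'
    exact hst ((hS i).unique ⟨hs, mem_frobOrbit.1 hi⟩ ⟨ht, mem_frobOrbit.1 hi'⟩)

end Orbit

section RootsOfUnity

variable {a : ℕ} {F E : Type*} [Field F] [Fintype F] [Field E] [Algebra F E] {ζ : E}

lemma IsPrimitiveRoot.pow_val_natCast (hζ : IsPrimitiveRoot ζ a) (n : ℕ) :
    ζ ^ (n : ZMod a).val = ζ ^ n := by
  rw [ZMod.val_natCast, hζ.eq_orderOf, pow_mod_orderOf]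

variable [NeZero a]

lemma IsPrimitiveRoot.pow_val_eq_iff (hζ : IsPrimitiveRoot ζ a) {i j : ZMod a} :
    ζ ^ i.val = ζ ^ j.val ↔ i = j :=
  ⟨fun h ↦ ZMod.val_injective a (hζ.pow_inj i.val_lt j.val_lt h), fun h ↦ by rw [h]⟩

lemma IsPrimitiveRoot.pow_val_mul (hζ : IsPrimitiveRoot ζ a) (q : ℕ) (i : ZMod a) :
    ζ ^ ((q : ZMod a) * i).val = (ζ ^ i.val) ^ q := by
  rw [← pow_mul, ← hζ.pow_val_natCast (i.val * q)]
  push_cast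
  rw [ZMod.natCast_zmod_val, mul_comm]

lemma map_minpoly_pow_val [Algebra.IsAlgebraic F E] (hq : (Fintype.card F).Coprime a)
    (hζ : IsPrimitiveRoot ζ a) (s : ZMod a) :
    (minpoly F (ζ ^ s.val)).map (algebraMap F E) =
      ∏ i ∈ frobOrbit a (Fintype.card F) s, (X - C (ζ ^ i.val)) := by
  classical
  have hint : IsIntegral F (ζ ^ s.val) := (Algebra.IsAlgebraic.isAlgebraic _).isIntegral
  set q := Fintype.card F
  set P : E[X] := ∏ i ∈ frobOrbit a q s, (X - C (ζ ^ i.val)) with hP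
  have hPm : P.Monic := monic_prod_of_monic _ _ fun i _ ↦ monic_X_sub_C _
  have hσ : P.map (FiniteField.frobeniusAlgHom F E : E →+* E) = P := by
    have hu : IsUnit (q : ZMod a) := (ZMod.isUnit_iff_coprime q a).2 hq
    rw [hP, Polynomial.map_prod]
    conv_rhs => rw [← image_mul_frobOrbit hq, Finset.prod_image hu.mul_right_injective.injOn]
    refine Finset.prod_congr rfl fun i _ ↦ ?_
    simp only [Polynomial.map_sub, map_X, map_C, hζ.pow_val_mul]
    rfl
  have hlift : P ∈ lifts (algebraMap F E) := by
    rw [lifts_iff_coeff_lifts]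
    intro n
    apply FiniteField.mem_range_algebraMap_of_pow_card_eq
    conv_rhs => rw [← hσ, coeff_map]
    simp
  obtain ⟨p, hp, -, hpm⟩ := lifts_and_natDegree_eq_and_monic hlift hPm
  refine eq_of_monic_of_associated ((minpoly.monic hint).map _) hPm
    (associated_of_dvd_dvd ?_ ?_)
  · rw [← hp]
    refine Polynomial.map_dvd _ (minpoly.dvd _ _ ?_)
    rw [← eval_map_algebraMap, hp, hP, eval_prod]
    exact Finset.prod_eq_zero (self_mem_frobOrbit s) (by simp)
  · refine Finset.prod_dvd_of_coprime ?_ ?_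
    · intro i _ j _ hij
      exact isCoprime_X_sub_C_of_isUnit_sub
        (sub_ne_zero.2 fun h ↦ hij (hζ.pow_val_eq_iff.1 h)).isUnit
    · intro i hi
      rw [dvd_iff_isRoot, IsRoot, eval_map_algebraMap]
      obtain ⟨e, rfl⟩ := mem_frobOrbit.1 hi
      induction e with
      | zero => simp
      | succ e ih =>
        have := ih (mem_frobOrbit.2 ⟨e, rfl⟩)
        rw [pow_succ', mul_assoc, hζ.pow_val_mul]
        have h2 := congrArg (FiniteField.frobeniusAlgHom F E) this
        rw [← Polynomial.aeval_algHom_apply] at h2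
        simpa using h2

variable [Algebra.IsAlgebraic F E]

lemma splits_map_minpoly_pow_val (hq : (Fintype.card F).Coprime a)
    (hζ : IsPrimitiveRoot ζ a) (s : ZMod a) :
    ((minpoly F (ζ ^ s.val)).map (algebraMap F E)).Splits := by
  rw [map_minpoly_pow_val hq hζ]
  exact Splits.prod fun i _ ↦ Splits.X_sub_C _

lemma natDegree_minpoly_pow_val (hq : (Fintype.card F).Coprime a)
    (hζ : IsPrimitiveRoot ζ a) (s : ZMod a) :
    (minpoly F (ζ ^ s.val)).natDegree = (frobOrbit a (Fintype.card F) s).card := by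
  rw [← natDegree_map (algebraMap F E), map_minpoly_pow_val hq hζ,
    natDegree_prod_of_monic _ _ fun i _ ↦ monic_X_sub_C _]
  simp_rw [natDegree_X_sub_C]
  simp

lemma prod_aroots_minpoly_pow_val (hq : (Fintype.card F).Coprime a)
    (hζ : IsPrimitiveRoot ζ a) (s : ZMod a) :
    ((minpoly F (ζ ^ s.val)).aroots E).prod =
      ∏ i ∈ frobOrbit a (Fintype.card F) s, ζ ^ i.val := by
  rw [aroots, map_minpoly_pow_val hq hζ, roots_prod _ _
    (Finset.prod_ne_zero_iff.2 fun i _ ↦ X_sub_C_ne_zero _)]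
  simp_rw [roots_X_sub_C, Multiset.bind_singleton]
  rfl

lemma prod_minpoly_pow_val (hq : (Fintype.card F).Coprime a)
    (hζ : IsPrimitiveRoot ζ a) {S : Finset (ZMod a)} (hS : IsOrbitRepSet a (Fintype.card F) S) :
    ∏ s : S, minpoly F (ζ ^ s.1.val) = X ^ a - 1 := by
  apply Polynomial.map_injective (algebraMap F E) (algebraMap F E).injective
  rw [Polynomial.map_prod]
  simp_rw [map_minpoly_pow_val hq hζ]
  rw [Finset.prod_coe_sort S fun s ↦ ∏ i ∈ frobOrbit a (Fintype.card F) s, (X - C (ζ ^ i.val)),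
    prod_prod_frobOrbit hS, Polynomial.map_sub, Polynomial.map_pow, Polynomial.map_X,
    Polynomial.map_one, X_pow_sub_one_eq_prod (NeZero.pos a) hζ]
  refine Finset.prod_bij (fun i _ ↦ ζ ^ i.val) ?_ ?_ ?_ ?_
  · intro i _
    rw [mem_nthRootsFinset (NeZero.pos a), ← pow_mul, mul_comm, pow_mul, hζ.pow_eq_one, one_pow]
  · intro i _ j _ h
    exact hζ.pow_val_eq_iff.1 h
  · intro x hx
    rw [mem_nthRootsFinset (NeZero.pos a)] at hx
    obtain ⟨i, hi, rfl⟩ := hζ.eq_pow_of_pow_eq_one hx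
    exact ⟨(i : ZMod a), Finset.mem_univ _, hζ.pow_val_natCast i⟩
  · intros; rfl

lemma isCoprime_minpoly_pow_val (hq : (Fintype.card F).Coprime a)
    (hζ : IsPrimitiveRoot ζ a) {S : Finset (ZMod a)} (hS : IsOrbitRepSet a (Fintype.card F) S) :
    Pairwise fun s t : S ↦ IsCoprime (minpoly F (ζ ^ s.1.val)) (minpoly F (ζ ^ t.1.val)) := by
  intro s t hst
  rw [← isCoprime_map (algebraMap F E), map_minpoly_pow_val hq hζ, map_minpoly_pow_val hq hζ]
  refine IsCoprime.prod_left fun i hi ↦ IsCoprime.prod_right fun j hj ↦ ?_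
  refine isCoprime_X_sub_C_of_isUnit_sub (sub_ne_zero.2 fun h ↦ hst ?_).isUnit
  obtain rfl := hζ.pow_val_eq_iff.1 h
  exact Subtype.ext ((hS i).unique ⟨s.2, mem_frobOrbit.1 hi⟩ ⟨t.2, mem_frobOrbit.1 hj⟩)

end RootsOfUnity

end CyclotomicFactors

section Endomorphisms

open Polynomial

section

variable {F ι V : Type*} [Field F] [Fintype ι] [AddCommGroup V] [Module F V]

lemma prod_smul_polyModel_eq_zero (f : ι → F[X]) (m : ι → ℕ) (x : PolyModel f m) :
    (∏ i, f i) • x = 0 := by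
  classical
  ext1 i
  rw [Pi.smul_apply, ← Finset.prod_erase_mul _ _ (Finset.mem_univ i), mul_smul,
    smul_fin_quotient_span_eq_zero, smul_zero, Pi.zero_apply]

lemma isTorsionBy_aeval'_iff {t : Module.End F V} {p : F[X]} :
    Module.IsTorsionBy F[X] (Module.AEval' t) p ↔ aeval t p = 0 := by
  rw [LinearMap.ext_iff]
  constructor
  · intro h v
    have := @h (Module.AEval'.of t v)
    rwa [← Module.AEval.of_aeval_smul, map_eq_zero_iff _ (LinearEquiv.injective _)] at this
  · intro h x
    obtain ⟨v, rfl⟩ := (Module.AEval'.of t).surjective x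
    rw [← Module.AEval.of_aeval_smul, map_eq_zero_iff _ (LinearEquiv.injective _)]
    exact h v

lemma aeval_prod_eq_zero_of_linearEquiv {t : Module.End F V} {f : ι → F[X]} {m : ι → ℕ}
    (e : Module.AEval' t ≃ₗ[F[X]] PolyModel f m) : aeval t (∏ i, f i) = 0 := by
  rw [← isTorsionBy_aeval'_iff]
  intro x
  apply e.injective
  rw [map_smul, prod_smul_polyModel_eq_zero, map_zero]

lemma exists_linearEquiv_polyModel [Module.Finite F V] {t : Module.End F V} {f : ι → F[X]}
    (hf : ∀ i, Irreducible (f i)) (hc : Pairwise fun i j ↦ IsCoprime (f i) (f j))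
    (ht : aeval t (∏ i, f i) = 0) :
    ∃ m : ι → ℕ, Nonempty (Module.AEval' t ≃ₗ[F[X]] PolyModel f m) := by
  have : Module.Finite F[X] (Module.AEval' t) := inferInstance
  exact exists_linearEquiv_pi_of_isTorsionBy hc (fun i ↦ isMaximal_span_of_irreducible (hf i))
    (isTorsionBy_aeval'_iff.2 ht)

lemma finrank_eq_of_aeval'_linearEquiv {W : Type*} [AddCommGroup W]
    [Module F W] [Module F[X] W] [IsScalarTower F F[X] W] {t : Module.End F V}
    (e : Module.AEval' t ≃ₗ[F[X]] W) : Module.finrank F V = Module.finrank F W :=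
  ((endOfLinearEquivFiber t).symm e).1.finrank_eq

lemma det_eq_of_aeval'_linearEquiv {W : Type*} [AddCommGroup W]
    [Module F W] [Module F[X] W] [IsScalarTower F F[X] W] {t : Module.End F V}
    (e : Module.AEval' t ≃ₗ[F[X]] W) :
    LinearMap.det t = LinearMap.det (Algebra.lsmul F F W (X : F[X])) := by
  conv_lhs => rw [← ((endOfLinearEquivFiber t).symm e).2]
  exact det_endOfLinearEquiv _

end

lemma jCount_eq_card_end {a n : ℕ} (ha : a ≠ 0) (F : Type) [Field F] [Fintype F]
    (ζ : AlgebraicClosure F) (k : ZMod a) :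
    jCount a n F ζ k = Nat.card {t : Module.End F (Fin n → F) // t ^ a = 1 ∧
      algebraMap F (AlgebraicClosure F) (LinearMap.det t) = ζ ^ k.val} := by
  refine Nat.card_congr (Equiv.ofBijective
    (fun t ↦ ⟨Matrix.toLinAlgEquiv' t.1.1, ?_, ?_⟩) ⟨?_, ?_⟩)
  · rw [← map_pow, ← Units.val_pow_eq_pow_val, t.2.1, Units.val_one, map_one]
  · refine (congrArg _ ?_).trans t.2.2
    exact LinearMap.det_toLin' _
  · intro t t' h
    exact Subtype.ext (Units.ext (Matrix.toLinAlgEquiv'.injective (congrArg Subtype.val h)))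
  · rintro ⟨t, h1, h2⟩
    have h3 : Matrix.toLinAlgEquiv'.symm t ^ a = 1 := by rw [← map_pow, h1, map_one]
    refine ⟨⟨Units.ofPowEqOne _ a h3 ha, ?_, ?_⟩, ?_⟩
    · ext1
      simp
    · rw [← h2, ← LinearMap.det_toMatrix']
      rfl
    · ext1
      exact Matrix.toLinAlgEquiv'.apply_symm_apply t

end Endomorphisms

section Counting

open Polynomial

section Invariant

variable {a q : ℕ} {S : Finset (ZMod a)} {m : ZMod a → ℤ}

lemma apply_pow_mul_of_invariant (hm : ∀ i, m ((q : ZMod a) * i) = m i) (e : ℕ) (i : ZMod a) :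
    m ((q : ZMod a) ^ e * i) = m i := by
  induction e with
  | zero => simp
  | succ e ih => rw [pow_succ', mul_assoc, hm, ih]

lemma exists_invariant_extension (hS : IsOrbitRepSet a q S) (μ : S → ℕ) :
    ∃ m : ZMod a → ℤ, (∀ i, m ((q : ZMod a) * i) = m i) ∧ (∀ i, 0 ≤ m i) ∧
      ∀ s : S, m s = μ s := by
  choose r hr hr' using hS
  refine ⟨fun i ↦ μ ⟨r i, (hr i).1⟩, fun i ↦ ?_, fun i ↦ by positivity, fun s ↦ ?_⟩
  · obtain ⟨e, he⟩ := (hr i).2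
    have : r i = r (q * i) := hr' (q * i) _ ⟨(hr i).1, e + 1, by rw [pow_succ', mul_assoc, he]⟩
    simp only [this]
  · have : s.1 = r s := hr' s _ ⟨s.2, 0, by simp⟩
    simp only [← this]

lemma eq_of_invariant_of_eq_on (hS : IsOrbitRepSet a q S) {m' : ZMod a → ℤ}
    (hm : ∀ i, m ((q : ZMod a) * i) = m i) (hm' : ∀ i, m' ((q : ZMod a) * i) = m' i)
    (h : ∀ s : S, m s = m' s) : m = m' := by
  funext i
  obtain ⟨s, ⟨hs, e, rfl⟩, -⟩ := hS i
  rw [apply_pow_mul_of_invariant hm, apply_pow_mul_of_invariant hm']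
  exact h ⟨s, hs⟩

lemma nonneg_of_invariant (hS : IsOrbitRepSet a q S)
    (hm : ∀ i, m ((q : ZMod a) * i) = m i) (h : ∀ s ∈ S, 0 ≤ m s) (i : ZMod a) : 0 ≤ m i := by
  obtain ⟨s, ⟨hs, e, rfl⟩, -⟩ := hS i
  rw [apply_pow_mul_of_invariant hm]
  exact h s hs

@[to_additive]
lemma prod_frobOrbit_of_invariant [NeZero a] (hS : IsOrbitRepSet a q S)
    (hm : ∀ i, m ((q : ZMod a) * i) = m i) {M : Type*} [CommMonoid M] (g : ZMod a → ℤ → M) :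
    ∏ s : S, ∏ i ∈ frobOrbit a q s, g i (m s) = ∏ i, g i (m i) := by
  rw [← prod_prod_frobOrbit hS, Finset.prod_coe_sort S fun s ↦ ∏ i ∈ frobOrbit a q s, g i (m s)]
  refine Finset.prod_congr rfl fun s _ ↦ Finset.prod_congr rfl fun i hi ↦ ?_
  obtain ⟨e, rfl⟩ := mem_frobOrbit.1 hi
  rw [apply_pow_mul_of_invariant hm]

end Invariant

section Count

variable {a : ℕ} [NeZero a] {F : Type*} [Field F] [Fintype F]
  {E : Type*} [Field E] [Algebra F E] {ζ : E} {S : Finset (ZMod a)} {m : ZMod a → ℤ}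

lemma IsPrimitiveRoot.prod_pow_val_pow {E : Type*} [Field E] {ζ : E} (hζ : IsPrimitiveRoot ζ a)
    (h0 : ∀ i, 0 ≤ m i) :
    ∏ i, (ζ ^ i.val) ^ (m i).toNat = ζ ^ (∑ i, i * (m i : ZMod a)).val := by
  let χ := AddChar.zmodChar a hζ.pow_eq_one
  have h1 : χ (∑ i, i * (m i : ZMod a)) = ∏ i, χ (i * (m i : ZMod a)) :=
    map_prod χ.toMonoidHom (fun i ↦ Multiplicative.ofAdd (i * (m i : ZMod a))) Finset.univ
  refine .trans ?_ h1.symm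
  refine Finset.prod_congr rfl fun i _ ↦ ?_
  obtain ⟨j, hj⟩ := Int.eq_ofNat_of_zero_le (h0 i)
  rw [hj, Int.cast_natCast, mul_comm, ← nsmul_eq_mul, χ.map_nsmul_eq_pow]
  rfl

/-- The `F[X]`-module `∏ s ∈ S, F(ζ ^ s) ^ m s`. -/
abbrev CycloModel (F : Type*) [Field F] {E : Type*} [Field E] [Algebra F E] (ζ : E)
    (S : Finset (ZMod a)) (m : ZMod a → ℤ) : Type _ :=
  PolyModel (fun s : S ↦ minpoly F (ζ ^ s.1.val)) fun s ↦ (m s).toNat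

variable [Algebra.IsAlgebraic F E]

lemma finrank_cycloModel (hq : (Fintype.card F).Coprime a)
    (hζ : IsPrimitiveRoot ζ a) (hS : IsOrbitRepSet a (Fintype.card F) S)
    (hm : ∀ i, m ((Fintype.card F : ZMod a) * i) = m i) (h0 : ∀ i, 0 ≤ m i) :
    (Module.finrank F (CycloModel F ζ S m) : ℤ) = ∑ i, m i := by
  rw [finrank_polyModel (f := fun s : S ↦ minpoly F (ζ ^ s.1.val)) fun s ↦
    minpoly.ne_zero (Algebra.IsAlgebraic.isAlgebraic (ζ ^ s.1.val)).isIntegral,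
    ← sum_frobOrbit_of_invariant hS hm fun _ x ↦ x]
  push_cast
  refine Finset.sum_congr rfl fun s _ ↦ ?_
  rw [natDegree_minpoly_pow_val hq hζ, Finset.sum_const, nsmul_eq_mul, Int.toNat_of_nonneg (h0 _),
    mul_comm]

lemma algebraMap_det_cycloModel (hq : (Fintype.card F).Coprime a)
    (hζ : IsPrimitiveRoot ζ a) (hS : IsOrbitRepSet a (Fintype.card F) S)
    (hm : ∀ i, m ((Fintype.card F : ZMod a) * i) = m i)
    (h0 : ∀ i, 0 ≤ m i) :
    algebraMap F E (LinearMap.det (Algebra.lsmul F F (CycloModel F ζ S m) (X : F[X]))) =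
      ζ ^ (∑ i, i * (m i : ZMod a)).val := by
  rw [algebraMap_det_polyModel (f := fun s : S ↦ minpoly F (ζ ^ s.1.val)) (fun s ↦
      minpoly.monic (Algebra.IsAlgebraic.isAlgebraic (ζ ^ s.1.val)).isIntegral)
    (fun s ↦ splits_map_minpoly_pow_val hq hζ s.1), ← hζ.prod_pow_val_pow h0,
    ← prod_frobOrbit_of_invariant hS hm fun i x ↦ (ζ ^ i.val) ^ x.toNat]
  refine Finset.prod_congr rfl fun s _ ↦ ?_
  rw [prod_aroots_minpoly_pow_val hq hζ, Finset.prod_pow]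

lemma card_end_eq_sum (hq : (Fintype.card F).Coprime a)
    (hζ : IsPrimitiveRoot ζ a) (hS : IsOrbitRepSet a (Fintype.card F) S)
    {n : ℕ} (k : ZMod a) (I : Finset (ZMod a → ℤ))
    (hI : ∀ m, m ∈ I ↔ ((∀ i, m ((Fintype.card F : ZMod a) * i) = m i) ∧ ∑ i, m i = n ∧
      ∑ i, i * (m i : ZMod a) = k) ∧ ∀ i, 0 ≤ m i) :
    Nat.card {t : Module.End F (Fin n → F) // t ^ a = 1 ∧
      algebraMap F E (LinearMap.det t) = ζ ^ k.val} =
    ∑ m ∈ I, Nat.card {t : Module.End F (Fin n → F) //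
      Nonempty (Module.AEval' t ≃ₗ[F[X]] CycloModel F ζ S m)} := by
  have hint (s : S) : IsIntegral F (ζ ^ s.1.val) :=
    (Algebra.IsAlgebraic.isAlgebraic (ζ ^ s.1.val)).isIntegral
  have hf (s : S) : Irreducible (minpoly F (ζ ^ s.1.val)) := minpoly.irreducible (hint s)
  have hc := isCoprime_minpoly_pow_val hq hζ hS
  have hprod := prod_minpoly_pow_val hq hζ hS
  have hpow (t : Module.End F (Fin n → F)) : aeval t (X ^ a - 1 : F[X]) = 0 ↔ t ^ a = 1 := by
    rw [map_sub, map_pow, aeval_X, map_one, sub_eq_zero]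
  have : Finite (Module.End F (Fin n → F)) := Module.finite_of_finite F
  rw [← Finset.sum_coe_sort I, ← Nat.card_sigma]
  have hmem (x : Σ m : I, {t : Module.End F (Fin n → F) //
      Nonempty (Module.AEval' t ≃ₗ[F[X]] CycloModel F ζ S m.1)}) :
      x.2.1 ^ a = 1 ∧ algebraMap F E (LinearMap.det x.2.1) = ζ ^ k.val := by
    obtain ⟨e⟩ := x.2.2
    obtain ⟨⟨h1, h2, h3⟩, h4⟩ := (hI _).1 x.1.2
    rw [← hpow, ← hprod, det_eq_of_aeval'_linearEquiv e, algebraMap_det_cycloModel hq hζ hS h1 h4,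
      h3]
    exact ⟨aeval_prod_eq_zero_of_linearEquiv e, rfl⟩
  refine (Nat.card_congr (Equiv.ofBijective (fun x ↦ ⟨x.2.1, hmem x⟩) ⟨?_, ?_⟩)).symm
  · rintro ⟨⟨m, hm⟩, t, ⟨e⟩⟩ ⟨⟨m', hm'⟩, t', ⟨e'⟩⟩ h
    obtain rfl : t = t' := congrArg Subtype.val h
    have h1 := polyModel_injective hf hc (e.symm.trans e')
    rw [hI] at hm hm'
    obtain rfl : m = m' := by
      refine eq_of_invariant_of_eq_on hS hm.1.1 hm'.1.1 fun s ↦ ?_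
      have h4 : (m s).toNat = (m' s).toNat := congrFun h1 s
      have h2 := hm.2 s
      have h3 := hm'.2 s
      omega
    rfl
  · rintro ⟨t, ht, hdet⟩
    rw [← hpow, ← hprod] at ht
    obtain ⟨μ, ⟨e⟩⟩ := exists_linearEquiv_polyModel hf hc ht
    obtain ⟨m, h1, h2, h3⟩ := exists_invariant_extension hS μ
    obtain rfl : (fun s : S ↦ (m s).toNat) = μ := by
      funext s
      simp [h3]
    refine ⟨⟨⟨m, (hI m).2 ⟨⟨h1, ?_, ?_⟩, h2⟩⟩, t, ⟨e⟩⟩, rfl⟩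
    · rw [← finrank_cycloModel hq hζ hS h1 h2, ← finrank_eq_of_aeval'_linearEquiv e]
      simp
    · rw [det_eq_of_aeval'_linearEquiv e, algebraMap_det_cycloModel hq hζ hS h1 h2] at hdet
      exact hζ.pow_val_eq_iff.1 hdet

lemma card_mul_card_cycloModel_aut (hq : (Fintype.card F).Coprime a)
    (hζ : IsPrimitiveRoot ζ a) (hS : IsOrbitRepSet a (Fintype.card F) S)
    {n : ℕ}
    (hm : ∀ i, m ((Fintype.card F : ZMod a) * i) = m i) (h0 : ∀ i, 0 ≤ m i) (hn : ∑ i, m i = n) :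
    Nat.card {t : Module.End F (Fin n → F) //
      Nonempty (Module.AEval' t ≃ₗ[F[X]] CycloModel F ζ S m)} *
    ∏ s : S, ∏ j : Fin (m s).toNat, ((Fintype.card F ^ orbitSize a (Fintype.card F) s) ^ (m s).toNat -
        (Fintype.card F ^ orbitSize a (Fintype.card F) s) ^ (j : ℕ)) =
    ∏ j : Fin n, (Fintype.card F ^ n - Fintype.card F ^ (j : ℕ)) := by
  have hint (s : S) : IsIntegral F (ζ ^ s.1.val) :=
    (Algebra.IsAlgebraic.isAlgebraic (ζ ^ s.1.val)).isIntegral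
  have hf (s : S) : Irreducible (minpoly F (ζ ^ s.1.val)) := minpoly.irreducible (hint s)
  have : Module.Finite F (CycloModel F ζ S m) := finite_polyModel (fun s ↦ (hf s).ne_zero) _
  have hfin : Module.finrank F (Fin n → F) = Module.finrank F (CycloModel F ζ S m) := by
    have := finrank_cycloModel hq hζ hS hm h0
    rw [hn] at this
    rw [Module.finrank_fin_fun]
    exact_mod_cast this.symm
  have h := card_mul_card_aut_eq (LinearEquiv.ofFinrankEq _ _ hfin)
  rw [card_polyModel_linearEquiv hf (isCoprime_minpoly_pow_val hq hζ hS)] at h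
  simp_rw [natDegree_minpoly_pow_val hq hζ, card_frobOrbit] at h
  rw [h, ← Matrix.card_GL_field]
  exact Nat.card_congr ((LinearMap.GeneralLinearGroup.generalLinearEquiv _ _).symm.trans
      Matrix.GeneralLinearGroup.toLin.symm).toEquiv

end Count

end Counting

section Asymptotics

open Polynomial Finset

lemma cast_prod_pow_sub_pow {Q : ℕ} (hQ : 1 ≤ Q) (m : ℕ) :
    ((∏ j : Fin m, (Q ^ m - Q ^ (j : ℕ)) : ℕ) : ℝ) = (Q : ℝ) ^ (m ^ 2) * qPoch Q m := by
  have hQ0 : (Q : ℝ) ≠ 0 := by positivity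
  rw [Fin.prod_univ_eq_prod_range fun j ↦ Q ^ m - Q ^ j, qPoch, sq, pow_mul,
    ← prod_range_reflect]
  have : ((Q : ℝ) ^ m) ^ m = ∏ j ∈ range m, (Q : ℝ) ^ m := by simp
  rw [this, ← prod_mul_distrib]
  push_cast
  refine prod_congr rfl fun j hj ↦ ?_
  have hj := mem_range.1 hj
  rw [Nat.cast_sub (Nat.pow_le_pow_right hQ (by lia))]
  push_cast
  rw [mul_sub, mul_one, inv_pow, ← div_eq_mul_inv, eq_comm, sub_right_inj, div_eq_iff (by positivity),
    ← pow_add]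
  congr 1
  lia

lemma one_le_orbitSize {a q : ℕ} [NeZero a] (s : ZMod a) : 1 ≤ orbitSize a q s := by
  rw [← card_frobOrbit]
  exact card_pos.2 ⟨s, self_mem_frobOrbit s⟩

section

variable {a : ℕ} [NeZero a] {F : Type*} [Field F] [Fintype F]
  {E : Type*} [Field E] [Algebra F E] {ζ : E} {S : Finset (ZMod a)} {m : ZMod a → ℤ}

lemma card_end_cycloModel_eq [Algebra.IsAlgebraic F E] (hq : (Fintype.card F).Coprime a)
    (hζ : IsPrimitiveRoot ζ a) (hS : IsOrbitRepSet a (Fintype.card F) S) {n : ℕ}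
    (hm : ∀ i, m ((Fintype.card F : ZMod a) * i) = m i) (h0 : ∀ i, 0 ≤ m i) (hn : ∑ i, m i = n) :
    (Nat.card {t : Module.End F (Fin n → F) //
      Nonempty (Module.AEval' t ≃ₗ[F[X]] CycloModel F ζ S m)} : ℝ) =
    weight (Fintype.card F) S (orbitSize a (Fintype.card F)) n m *
      (Fintype.card F : ℝ) ^ ((n : ℝ) ^ 2 - ∑ i, (m i : ℝ) ^ 2) := by
  have h := congrArg (Nat.cast : ℕ → ℝ) (card_mul_card_cycloModel_aut hq hζ hS hm h0 hn)
  have hq1 : 1 < Fintype.card F := Fintype.one_lt_card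
  set q := Fintype.card F
  have hq2 : (2 : ℝ) ≤ q := by exact_mod_cast hq1
  have hq0 : (0 : ℝ) < q := by positivity
  have hpoch (s : ZMod a) : 0 < qPoch ((q : ℝ) ^ orbitSize a q s) (m s).toNat := by
    have := quarter_le_qPoch (Q := (q : ℝ) ^ orbitSize a q s)
      (hq2.trans (le_self_pow₀ (by linarith) (Nat.one_le_iff_ne_zero.1 (one_le_orbitSize s)))) (m s).toNat
    linarith
  rw [Nat.cast_mul, cast_prod_pow_sub_pow hq1.le, Nat.cast_prod] at h
  simp_rw [cast_prod_pow_sub_pow (Nat.one_le_pow _ _ hq1.le)] at h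
  rw [prod_mul_distrib] at h
  have hsum : ∏ s : S, ((q ^ orbitSize a q s : ℕ) : ℝ) ^ ((m s).toNat ^ 2) =
      (q : ℝ) ^ (∑ i, (m i : ℝ) ^ 2) := by
    rw [← sum_frobOrbit_of_invariant hS hm fun _ x ↦ (x : ℝ) ^ 2, Real.rpow_sum_of_pos hq0]
    refine prod_congr rfl fun s _ ↦ ?_
    rw [sum_const, card_frobOrbit]
    push_cast
    rw [← pow_mul, ← Real.rpow_natCast]
    congr 1
    obtain ⟨j, hj⟩ := Int.eq_ofNat_of_zero_le (h0 s)
    rw [hj]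
    simp
  have hw : ∏ s ∈ S, qPochInv ((q : ℝ) ^ orbitSize a q s) (m s) =
      (∏ s : S, qPoch ((q ^ orbitSize a q s : ℕ) : ℝ) (m s).toNat)⁻¹ := by
    rw [← prod_inv_distrib, ← prod_coe_sort S]
    refine prod_congr rfl fun s _ ↦ ?_
    rw [qPochInv, if_pos (h0 _)]
    push_cast
    rfl
  have hne : ∏ s : S, qPoch ((q ^ orbitSize a q s : ℕ) : ℝ) (m s).toNat ≠ 0 := by
    refine prod_ne_zero_iff.2 fun s _ ↦ ?_
    push_cast
    exact (hpoch s).ne'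
  rw [hsum] at h
  have hr : (q : ℝ) ^ (∑ i, (m i : ℝ) ^ 2) ≠ 0 := (Real.rpow_pos_of_pos hq0 _).ne'
  rw [weight, hw, Real.rpow_sub hq0]
  have hn2 : (q : ℝ) ^ ((n : ℝ) ^ 2) = (q : ℝ) ^ (n ^ 2) := by
    exact_mod_cast Real.rpow_natCast (q : ℝ) (n ^ 2)
  rw [hn2]
  field_simp
  linear_combination h

end

theorem jCount_mul_rpow_eq_tsum {a n : ℕ} [NeZero a] {F : Type} [Field F] [Fintype F]
    (hq : (Fintype.card F).Coprime a) {ζ : AlgebraicClosure F} (hζ : IsPrimitiveRoot ζ a)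
    {S : Finset (ZMod a)} (hS : IsOrbitRepSet a (Fintype.card F) S) (k : ZMod a) :
    (jCount a n F ζ k : ℝ) * (Fintype.card F : ℝ) ^ (-((1 - 1 / (a : ℝ)) * (n : ℝ) ^ 2)) =
      ∑' m : {m : ZMod a → ℤ // (∀ i, m ((Fintype.card F : ZMod a) * i) = m i) ∧
          ∑ i, m i = n ∧ ∑ i, i * (m i : ZMod a) = k},
        weight (Fintype.card F) S (orbitSize a (Fintype.card F)) n m.1 *
          (Fintype.card F : ℝ) ^ (-∑ i, ((m.1 i : ℝ) - n / Fintype.card (ZMod a)) ^ 2) := by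
  classical
  have ha0 : (a : ℝ) ≠ 0 := Nat.cast_ne_zero.2 (NeZero.ne a)
  have hq0 : (0 : ℝ) < Fintype.card F := by exact_mod_cast Fintype.card_pos
  let P (m : ZMod a → ℤ) : Prop := (∀ i, m ((Fintype.card F : ZMod a) * i) = m i) ∧
          ∑ i, m i = n ∧ ∑ i, i * (m i : ZMod a) = k
  let g (m : ZMod a → ℤ) : ℝ := weight (Fintype.card F) S (orbitSize a (Fintype.card F)) n m *
          (Fintype.card F : ℝ) ^ (-∑ i, ((m i : ℝ) - n / Fintype.card (ZMod a)) ^ 2)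
  let I : Finset (ZMod a → ℤ) := (Finset.Icc 0 (fun _ ↦ (n : ℤ))).filter P
  have hI (m : ZMod a → ℤ) : m ∈ I ↔ P m ∧ ∀ i, 0 ≤ m i := by
    rw [mem_filter, mem_Icc, and_comm]
    refine and_congr_right fun hP ↦ ⟨fun h ↦ h.1, fun h ↦ ⟨h, fun i ↦ ?_⟩⟩
    show m i ≤ n
    rw [← hP.2.1]
    exact single_le_sum (fun j _ ↦ h j) (mem_univ i)
  have hg (m : {m // P m}) (hm : m ∉ I.subtype P) : g m = 0 := by
    rw [mem_subtype, hI, not_and] at hm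
    have h1 : ∃ s ∈ S, m.1 s < 0 := by
      by_contra! h
      exact hm m.2 (nonneg_of_invariant hS m.2.1 h)
    obtain ⟨s, hs, h2⟩ := h1
    have h3 : weight (Fintype.card F) S (orbitSize a (Fintype.card F)) n m.1 = 0 := by
      rw [weight, prod_eq_zero hs (if_neg h2.not_ge), mul_zero]
    simp only [g, h3, zero_mul]
  change _ = ∑' m : {m // P m}, g m
  rw [tsum_eq_sum hg, jCount_eq_card_end (NeZero.ne a), card_end_eq_sum hq hζ hS k I hI,
    Nat.cast_sum, sum_mul, sum_subtype_of_mem g fun m hm ↦ ((hI m).1 hm).1]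
  refine sum_congr rfl fun m hm ↦ ?_
  obtain ⟨⟨h1, h2, h3⟩, h4⟩ := (hI m).1 hm
  rw [card_end_cycloModel_eq hq hζ hS h1 h4 h2, mul_assoc, ← Real.rpow_add hq0]
  congr 2
  have h5 : ∑ i, (m i : ℝ) = n := by exact_mod_cast congrArg (Int.cast : ℤ → ℝ) h2
  simp_rw [sub_sq, sum_add_distrib, sum_sub_distrib, ← sum_mul, ← mul_sum, h5]
  rw [ZMod.card]
  simp only [sum_const, card_univ, ZMod.card, nsmul_eq_mul]
  field_simp
  ring

lemma qPochInf_eq_tprod_rpow {q : ℝ} (hq : 0 ≤ q) (l : ℕ) :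
    qPochInf (q ^ l) = ∏' j : ℕ, (1 - q ^ (-((l : ℝ) * (j + 1 : ℝ)))) := by
  refine tprod_congr fun j ↦ ?_
  rw [Real.rpow_neg hq, Real.rpow_mul hq, Real.rpow_natCast, inv_pow, ← Real.rpow_natCast (q ^ l)]
  push_cast
  rfl

lemma cconst_eq_weightInf_mul_tsum {a : ℕ} [NeZero a] (q n : ℕ) (k : ZMod a) (S : Finset (ZMod a)) :
    Cconst a q n k S = weightInf q S (orbitSize a q) *
      ∑' m : {m : ZMod a → ℤ // (∀ i, m ((q : ZMod a) * i) = m i) ∧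
          ∑ i, m i = n ∧ ∑ i, i * (m i : ZMod a) = k},
        (q : ℝ) ^ (-∑ i, ((m.1 i : ℝ) - n / Fintype.card (ZMod a)) ^ 2) := by
  have h1 := qPochInf_eq_tprod_rpow (Nat.cast_nonneg q) 1
  simp only [pow_one, Nat.cast_one, one_mul] at h1
  simp_rw [Cconst, weightInf, h1, qPochInf_eq_tprod_rpow (Nat.cast_nonneg q),
    finsum_eq_sum_of_fintype, ZMod.card]
  congr 1
  exact (Equiv.subtypeEquivRight fun m ↦ by simp_rw [finsum_eq_sum_of_fintype]).tsum_eq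
    fun m : {m : ZMod a → ℤ // (∀ i, m ((q : ZMod a) * i) = m i) ∧
      ∑ i, m i = n ∧ ∑ i, i * (m i : ZMod a) = k} ↦
        (q : ℝ) ^ (-∑ i, ((m.1 i : ℝ) - n / a) ^ 2)

end Asymptotics

theorem stmt_10 (a : ℕ) (ha : 2 ≤ a) (ε : ℝ) (hε : 0 < ε) :
    ∃ N : ℕ, ∀ q : ℕ, IsPrimePow q → Nat.Coprime q a →
      ∀ n : ℕ, N < n → ∀ k : ZMod a,
      ∀ (F : Type) [Field F] [Fintype F], Fintype.card F = q →
      ∀ ζ : AlgebraicClosure F, IsPrimitiveRoot ζ a →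
      ∀ S : Finset (ZMod a), IsOrbitRepSet a q S →
      |(jCount a n F ζ k : ℝ) * (q : ℝ) ^ (-((1 - 1 / (a : ℝ)) * (n : ℝ) ^ 2)) -
          Cconst a q n k S| < ε := by
  have : NeZero a := ⟨by lia⟩
  obtain ⟨N, hN⟩ := exists_forall_abs_tsum_weight_sub_lt (ZMod a) hε
  refine ⟨N, ?_⟩
  rintro q hq hqa n hn k F _ _ rfl ζ hζ S hS
  rw [jCount_mul_rpow_eq_tsum hqa hζ hS, cconst_eq_weightInf_mul_tsum]
  exact hN _ (by exact_mod_cast hq.two_le) n hn S _ one_le_orbitSize _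
end
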